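/- arXiv:2407.12984 — 7 statements merged into one kernel-verified Lean document; each statement's English description precedes it below -/
import Mathlib

section
/- Linear convergence of the Polyak subgradient method: there exist universal constants C, c > 0 such that the following holds. Suppose ‖x⋆‖ ≥ 1 and m ≥ C·d·‖x⋆‖⁴. Set μ := 1/(4·√π·(1 + 9π·‖x⋆‖²)), L := 1 + 2·√(d/m), κ := 8·√π·(1 + 9π·‖x⋆‖²), and fix any 0 < η ≤ 1/κ. Define the iterates x₀ := 0 and x_{k+1} := x_k − η·(f(x_k)/‖g(x_k)‖²)·g(x_k) (with the convention x_{k+1} := x_k whenever g(x_k) = 0). Let ρ̄ := η·(μ/L)²/(40·√π·‖x⋆‖) and T₀ := ⌈log 2 / ρ̄⌉. Then with probability at least 1 − c·exp(−d/2) over the draw of (a₁, …, a_m), the iterates satisfy ‖x_{i+1} − x⋆‖² ≤ (1 − (η/5)·κ^{−5/2})·‖x_i − x⋆‖² for every 0 ≤ i < T₀, and ‖x_{i+1} − x⋆‖² ≤ (1 − η·κ^{−2})·‖x_i − x⋆‖² for every i ≥ T₀. -/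
open MeasureTheory ProbabilityTheory Real
open scoped RealInnerProductSpace ENNReal BigOperators Classical

noncomputable section

/-- Standard Gaussian measure `N(0, I_d)` on `ℝ^d`. -/
def stdGaussian (d : ℕ) : Measure (EuclideanSpace ℝ (Fin d)) :=
  (Measure.pi fun _ : Fin d => gaussianReal 0 1).map (EuclideanSpace.equiv (Fin d) ℝ).symm

/-- The joint distribution of `m` i.i.d. standard Gaussian vectors in `ℝ^d`. -/
def iidGaussian (d m : ℕ) : Measure (Fin m → EuclideanSpace ℝ (Fin d)) :=
  Measure.pi fun _ : Fin m => stdGaussian d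

/-- The loss `f(x) = (1/m) ∑ᵢ |yᵢ - hᵢ(x)|` where `yᵢ = 1 - exp(-⟨aᵢ,x⋆⟩₊)` and
`hᵢ(x) = 1 - exp(-⟨aᵢ,x⟩₊)`. -/
def loss {d m : ℕ} (xstar : EuclideanSpace ℝ (Fin d))
    (a : Fin m → EuclideanSpace ℝ (Fin d)) (x : EuclideanSpace ℝ (Fin d)) : ℝ :=
  (1 / m) * ∑ i, |(1 - Real.exp (-max ⟪a i, xstar⟫ 0)) - (1 - Real.exp (-max ⟪a i, x⟫ 0))|

/-- The complementary error function `erfc(t) = (2/√π) ∫_t^∞ exp(-u²) du`. -/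
def erfc (t : ℝ) : ℝ := 2 / Real.sqrt π * ∫ u in Set.Ioi t, Real.exp (-u ^ 2)

/-- `sgn₀(t) = 1` for `t > 0`, `-1` for `t < 0`, and `0` at `t = 0`. -/
def sgn0 (t : ℝ) : ℝ := if 0 < t then 1 else if t < 0 then -1 else 0

/-- `𝟙₊(t) = 1` for `t ≥ 0` and `0` for `t < 0`. -/
def indNonneg (t : ℝ) : ℝ := if 0 ≤ t then 1 else 0

/-- The explicit subgradient selection
`g(x) = -(1/m) ∑ᵢ sgn₀(yᵢ - hᵢ(x)) exp(-⟨aᵢ,x⟩₊) 𝟙₊(⟨aᵢ,x⟩) aᵢ`. -/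
def subgrad {d m : ℕ} (xstar : EuclideanSpace ℝ (Fin d))
    (a : Fin m → EuclideanSpace ℝ (Fin d)) (x : EuclideanSpace ℝ (Fin d)) :
    EuclideanSpace ℝ (Fin d) :=
  -((1 / m : ℝ) • ∑ i,
      (sgn0 ((1 - Real.exp (-max ⟪a i, xstar⟫ 0)) - (1 - Real.exp (-max ⟪a i, x⟫ 0))) *
        Real.exp (-max ⟪a i, x⟫ 0) * indNonneg ⟪a i, x⟫) • a i)

namespace PSGM

/-- auxiliary minorant -/
def psi (z t : ℝ) : ℝ := Real.exp (-max z 0) * min (1 - Real.exp (-|t|)) (max z 0)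

lemma psi_nonneg (z t : ℝ) : 0 ≤ psi z t := by
  unfold psi
  refine mul_nonneg (Real.exp_pos _).le (le_min ?_ (le_max_right _ _))
  have : Real.exp (-|t|) ≤ 1 := Real.exp_le_one_iff.2 (by simp)
  linarith

lemma psi_le_one (z t : ℝ) : psi z t ≤ 1 := by
  unfold psi
  have h1 : Real.exp (-max z 0) ≤ 1 := Real.exp_le_one_iff.2 (by simp)
  have h2 : min (1 - Real.exp (-|t|)) (max z 0) ≤ 1 :=
    (min_le_left _ _).trans (by linarith [Real.exp_pos (-|t|)])
  have h3 : 0 ≤ min (1 - Real.exp (-|t|)) (max z 0) := by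
    refine le_min ?_ (le_max_right _ _)
    have : Real.exp (-|t|) ≤ 1 := Real.exp_le_one_iff.2 (by simp)
    linarith
  nlinarith [Real.exp_pos (-max z 0)]

lemma psi_abs_right (z t : ℝ) : psi z (-t) = psi z t := by simp [psi]

lemma exp_neg_lip {x y : ℝ} (hx : 0 ≤ x) (hy : 0 ≤ y) :
    |Real.exp (-x) - Real.exp (-y)| ≤ |x - y| := by
  wlog h : x ≤ y generalizing x y
  · rw [abs_sub_comm, abs_sub_comm x y]; exact this hy hx (le_of_not_ge h)
  have h1 : Real.exp (-y) ≤ Real.exp (-x) := Real.exp_le_exp.2 (by linarith)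
  rw [abs_of_nonneg (by linarith), abs_of_nonpos (by linarith)]
  have h2 : Real.exp (-y) = Real.exp (-x) * Real.exp (x - y) := by
    rw [← Real.exp_add]; ring_nf
  have h3 := Real.add_one_le_exp (x - y)
  have h4 : Real.exp (-x) ≤ 1 := Real.exp_le_one_iff.2 (by linarith)
  rw [h2]
  nlinarith [Real.exp_pos (-x)]

lemma psi_lip (z t z' t' : ℝ) : |psi z t - psi z' t'| ≤ 2 * |z - z'| + |t - t'| := by
  unfold psi
  set e := Real.exp (-max z 0)
  set e' := Real.exp (-max z' 0)
  set q := min (1 - Real.exp (-|t|)) (max z 0)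
  set q' := min (1 - Real.exp (-|t'|)) (max z' 0)
  have hz : |max z 0 - max z' 0| ≤ |z - z'| := abs_max_sub_max_le_abs _ _ _
  have he : |e - e'| ≤ |z - z'| := (exp_neg_lip (le_max_right _ _) (le_max_right _ _)).trans hz
  have ht : |Real.exp (-|t|) - Real.exp (-|t'|)| ≤ |t - t'| :=
    (exp_neg_lip (abs_nonneg _) (abs_nonneg _)).trans (abs_abs_sub_abs_le_abs_sub _ _)
  have hq : |q - q'| ≤ |z - z'| + |t - t'| := by
    refine (abs_min_sub_min_le_max _ _ _ _).trans (max_le ?_ ?_)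
    · rw [show 1 - Real.exp (-|t|) - (1 - Real.exp (-|t'|)) =
        -(Real.exp (-|t|) - Real.exp (-|t'|)) by ring, abs_neg]
      linarith [abs_nonneg (z - z')]
    · linarith [abs_nonneg (t - t')]
  have e1 : |e| ≤ 1 := by
    rw [abs_of_pos (Real.exp_pos _)]; exact Real.exp_le_one_iff.2 (by simp)
  have q1 : |q'| ≤ 1 := by
    have h3 : 0 ≤ q' := by
      refine le_min ?_ (le_max_right _ _)
      have : Real.exp (-|t'|) ≤ 1 := Real.exp_le_one_iff.2 (by simp)
      linarith
    rw [abs_of_nonneg h3]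
    exact (min_le_left _ _).trans (by linarith [Real.exp_pos (-|t'|)])
  calc |e * q - e' * q'| = |e * (q - q') + (e - e') * q'| := by ring_nf
    _ ≤ |e * (q - q')| + |(e - e') * q'| := abs_add_le _ _
    _ = |e| * |q - q'| + |e - e'| * |q'| := by rw [abs_mul, abs_mul]
    _ ≤ 1 * |q - q'| + |e - e'| * 1 := by gcongr
    _ ≤ _ := by linarith

lemma psi_cont : Continuous fun p : ℝ × ℝ => psi p.1 p.2 := by
  unfold psi; fun_prop

/-- concavity: `1 - e^{-D t} ≥ (D/R)(1 - e^{-R t})`. -/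
lemma conc {D R t : ℝ} (hD : 0 ≤ D) (hR : 0 < R) (hDR : D ≤ R) :
    D / R * (1 - Real.exp (-(R * t))) ≤ 1 - Real.exp (-(D * t)) := by
  have h := convexOn_exp.2 (Set.mem_univ (-(R*t))) (Set.mem_univ 0)
    (show 0 ≤ D / R by positivity)
    (show 0 ≤ 1 - D / R by rw [sub_nonneg, div_le_one hR]; exact hDR) (by ring)
  have e : D / R * -(R * t) + (1 - D / R) * 0 = -(D * t) := by field_simp; ring
  simp only [smul_eq_mul, Real.exp_zero, e] at h
  linarith

lemma f_term {u v δ D R : ℝ} (hD : 0 ≤ D) (hR : 0 < R) (hDR : D ≤ R) (hv : v = u + D * δ) :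
    D / R * psi u (R * δ) ≤
      |(1 - Real.exp (-max u 0)) - (1 - Real.exp (-max v 0))| := by
  rcases le_or_gt u 0 with hu | hu
  · have : psi u (R * δ) = 0 := by
      unfold psi
      rw [max_eq_right hu, min_eq_right]
      · simp
      · have : Real.exp (-|R * δ|) ≤ 1 := Real.exp_le_one_iff.2 (neg_nonpos.2 (abs_nonneg _))
        linarith
    rw [this]; simp
  have hDR0 : 0 ≤ D / R := by positivity
  have hDR1 : D / R ≤ 1 := by rw [div_le_one hR]; exact hDR
  have e0 := Real.exp_pos (-u)
  unfold psi
  rw [max_eq_left hu.le]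
  rcases le_or_gt 0 δ with hδ | hδ
  · have hvu : u ≤ v := by rw [hv]; nlinarith
    rw [max_eq_left (hu.le.trans hvu)]
    refine le_trans ?_ (neg_le_abs _)
    have e1 : Real.exp (-v) = Real.exp (-u) * Real.exp (-(D * δ)) := by
      rw [← Real.exp_add, hv]; ring_nf
    have h1 := conc (t := δ) hD hR hDR
    rw [abs_of_nonneg (mul_nonneg hR.le hδ)]
    have h2 : D / R * min (1 - Real.exp (-(R * δ))) u ≤ 1 - Real.exp (-(D * δ)) :=
      (mul_le_mul_of_nonneg_left (min_le_left _ _) hDR0).trans h1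
    rw [e1]
    nlinarith
  · have hvu : max v 0 ≤ u := max_le (by rw [hv]; nlinarith) hu.le
    have e1 : Real.exp (-max v 0) = Real.exp (-u) * Real.exp (u - max v 0) := by
      rw [← Real.exp_add]; ring_nf
    refine le_trans ?_ (le_abs_self _)
    have h3 := Real.add_one_le_exp (u - max v 0)
    have h4 : D / R * min (1 - Real.exp (-|R * δ|)) u ≤ u - max v 0 := by
      rcases le_total v 0 with h | h
      · rw [max_eq_right h]
        have : min (1 - Real.exp (-|R * δ|)) u ≤ u := min_le_right _ _
        calc _ ≤ D / R * u := by gcongr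
          _ ≤ _ := by nlinarith
      · rw [max_eq_left h]
        have h5 : min (1 - Real.exp (-|R * δ|)) u ≤ -(R * δ) := by
          refine (min_le_left _ _).trans ?_
          rw [abs_of_nonpos (by nlinarith)]
          have := Real.add_one_le_exp (-(-(R*δ)))
          linarith
        calc _ ≤ D / R * (-(R * δ)) := by gcongr
          _ = -(D * δ) := by field_simp
          _ ≤ _ := by rw [hv]; linarith
    rw [e1]
    nlinarith

/-- the coefficient times `u - v` -/
def aTerm (u v : ℝ) : ℝ :=
  sgn0 ((1 - Real.exp (-max u 0)) - (1 - Real.exp (-max v 0))) *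
        Real.exp (-max v 0) * indNonneg v * (u - v)

lemma aTerm_eq_of_pos {u v : ℝ} (hv : 0 < v) : aTerm u v = Real.exp (-v) * |u - v| := by
  unfold aTerm indNonneg sgn0
  rw [max_eq_left hv.le, if_pos hv.le]
  rcases lt_trichotomy u v with h | h | h
  · have h1 : max u 0 < v := max_lt h hv
    have := Real.exp_lt_exp.2 (neg_lt_neg h1)
    rw [if_neg (by linarith), if_pos (by linarith), abs_of_neg (by linarith)]; ring
  · subst h; simp
  · have h1 : v < max u 0 := lt_max_of_lt_left h
    have := Real.exp_lt_exp.2 (neg_lt_neg h1)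
    rw [if_pos (by linarith), abs_of_pos (by linarith)]; ring

lemma aTerm_zero (u : ℝ) : aTerm u 0 = max u 0 := by
  unfold aTerm indNonneg sgn0
  rcases le_or_gt u 0 with h | h
  · rw [max_eq_right h]; simp
  · have := Real.exp_lt_one_iff.2 (neg_lt_zero.2 h)
    rw [max_eq_left h.le]; simp
    intro h'; linarith

lemma aTerm_nonneg (u v : ℝ) : 0 ≤ aTerm u v := by
  rcases lt_trichotomy v 0 with h | h | h
  · unfold aTerm indNonneg; rw [if_neg (not_le.2 h)]; simp
  · subst h; rw [aTerm_zero]; exact le_max_right _ _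
  · rw [aTerm_eq_of_pos h]; positivity

lemma psi_of_nonpos {z : ℝ} (t : ℝ) (hz : z ≤ 0) : psi z t = 0 := by
  unfold psi
  rw [max_eq_right hz, min_eq_right]
  · simp
  · have : Real.exp (-|t|) ≤ 1 := Real.exp_le_one_iff.2 (by simp)
    linarith

lemma psi_le {z t : ℝ} (hz : 0 < z) : psi z t ≤ Real.exp (-z) * |t| := by
  unfold psi
  rw [max_eq_left hz.le]
  refine mul_le_mul_of_nonneg_left ((min_le_left _ _).trans ?_) (Real.exp_pos _).le
  linarith [Real.add_one_le_exp (-|t|)]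

/-- main case -/
lemma a_term {u v ζ θ δ D R : ℝ} (hD : 0 ≤ D) (hR : 0 < R) (hθ : 1 ≤ θ) (hζ : ζ = θ * v)
    (hv : v = u + D * δ) : D / R * psi ζ (R * δ) ≤ aTerm u v := by
  rcases le_or_gt v 0 with h | h
  · rw [psi_of_nonpos _ (by rw [hζ]; nlinarith)]; simpa using aTerm_nonneg u v
  · have hz : v ≤ ζ := by rw [hζ]; nlinarith
    rw [aTerm_eq_of_pos h]
    have h1 := psi_le (t := R * δ) (h.trans_le hz)
    have h2 : |u - v| = D * |δ| := by
      rw [hv, show u - (u + D * δ) = -(D * δ) by ring, abs_neg, abs_mul, abs_of_nonneg hD]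
    have h3 : Real.exp (-ζ) ≤ Real.exp (-v) := Real.exp_le_exp.2 (by linarith)
    calc _ ≤ D / R * (Real.exp (-ζ) * |R * δ|) := by gcongr
      _ = Real.exp (-ζ) * (D * |δ|) := by rw [abs_mul, abs_of_pos hR]; field_simp
      _ ≤ _ := by rw [h2]; gcongr

/-- start case -/
lemma a_term0 {u R : ℝ} (hR : 0 < R) : R / R * psi (u / R) (R * (-(u / R))) ≤ aTerm u 0 := by
  rw [aTerm_zero, div_self hR.ne', one_mul]
  rcases le_or_gt u 0 with h | h
  · rw [psi_of_nonpos _ (div_nonpos_of_nonpos_of_nonneg h hR.le)]; exact le_max_right _ _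
  · have h1 := psi_le (t := R * (-(u / R))) (div_pos h hR)
    have h2 : |R * (-(u / R))| = u := by
      rw [mul_neg, abs_neg, mul_div_cancel₀ _ hR.ne', abs_of_pos h]
    rw [h2] at h1
    have : Real.exp (-(u/R)) ≤ 1 := Real.exp_le_one_iff.2 (by have := div_pos h hR; linarith)
    rw [max_eq_left h.le]; nlinarith

end PSGM
namespace PSGM

variable {d m : ℕ}

lemma sgn0_abs_le (t : ℝ) : |sgn0 t| ≤ 1 := by
  unfold sgn0; split_ifs <;> simp

lemma indNonneg_abs_le (t : ℝ) : |indNonneg t| ≤ 1 := by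
  unfold indNonneg; split_ifs <;> simp

lemma inner_subgrad (xstar x w : EuclideanSpace ℝ (Fin d)) (a : Fin m → EuclideanSpace ℝ (Fin d)) :
    ⟪subgrad xstar a x, w⟫ = (1 / m : ℝ) * ∑ i,
      (sgn0 ((1 - Real.exp (-max ⟪a i, xstar⟫ 0)) - (1 - Real.exp (-max ⟪a i, x⟫ 0))) *
        Real.exp (-max ⟪a i, x⟫ 0) * indNonneg ⟪a i, x⟫) * (-⟪a i, w⟫) := by
  unfold subgrad
  rw [inner_neg_left, real_inner_smul_left, sum_inner, ← mul_neg, ← Finset.sum_neg_distrib]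
  congr 1
  refine Finset.sum_congr rfl fun i _ => ?_
  rw [real_inner_smul_left]; ring

lemma subgrad_norm_le (xstar x : EuclideanSpace ℝ (Fin d)) (a : Fin m → EuclideanSpace ℝ (Fin d))
    {s : ℝ} (hs : 0 ≤ s)
    (hS : ∀ w, (1 / m : ℝ) * ∑ i, |⟪a i, w⟫| ≤ s * ‖w‖) : ‖subgrad xstar a x‖ ≤ s := by
  set g := subgrad xstar a x with hg
  have h1 : ‖g‖ ^ 2 ≤ s * ‖g‖ := by
    rw [← real_inner_self_eq_norm_sq]
    refine le_trans ?_ (hS g)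
    conv_lhs => rw [hg]
    rw [inner_subgrad]
    refine mul_le_mul_of_nonneg_left (Finset.sum_le_sum fun i _ => ?_) (by positivity)
    refine (le_abs_self _).trans ?_
    rw [abs_mul, abs_mul, abs_mul, abs_neg, abs_of_pos (Real.exp_pos _)]
    have e : Real.exp (-max ⟪a i, x⟫ 0) ≤ 1 := Real.exp_le_one_iff.2 (by simp)
    calc _ ≤ (1 * 1 * 1) * |⟪a i, g⟫| := by
          gcongr
          · exact sgn0_abs_le _
          · exact indNonneg_abs_le _
      _ = _ := by ring
  by_contra h
  push Not at h
  nlinarith [norm_nonneg g]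

lemma loss_nonneg (xstar x : EuclideanSpace ℝ (Fin d)) (a : Fin m → EuclideanSpace ℝ (Fin d)) :
    0 ≤ loss xstar a x := by
  unfold loss; positivity

lemma loss_le (xstar x : EuclideanSpace ℝ (Fin d)) (a : Fin m → EuclideanSpace ℝ (Fin d))
    {s : ℝ} (hS : ∀ w, (1 / m : ℝ) * ∑ i, |⟪a i, w⟫| ≤ s * ‖w‖) :
    loss xstar a x ≤ s * ‖x - xstar‖ := by
  refine le_trans ?_ (hS _)
  unfold loss
  refine mul_le_mul_of_nonneg_left (Finset.sum_le_sum fun i _ => ?_) (by positivity)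
  rw [inner_sub_right]
  calc _ = |Real.exp (-max ⟪a i, x⟫ 0) - Real.exp (-max ⟪a i, xstar⟫ 0)| := by ring_nf
    _ ≤ |max ⟪a i, x⟫ 0 - max ⟪a i, xstar⟫ 0| :=
        exp_neg_lip (le_max_right _ _) (le_max_right _ _)
    _ ≤ _ := abs_max_sub_max_le_abs _ _ _

lemma loss_ge (xstar x : EuclideanSpace ℝ (Fin d)) (a : Fin m → EuclideanSpace ℝ (Fin d))
    {R p : ℝ} (hR : ‖xstar‖ = R) (hR1 : 1 ≤ R) (hx : ‖x - xstar‖ ≤ R) (hx0 : x ≠ xstar)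
    (hP : ∀ z w : EuclideanSpace ℝ (Fin d), 1 ≤ ‖z‖ → ‖z‖ ≤ 2 * R → ‖w‖ = 1 →
      p / R ≤ (1 / m : ℝ) * ∑ i, psi ⟪a i, z⟫ (R * ⟪a i, w⟫)) :
    p * ‖x - xstar‖ / R ^ 2 ≤ loss xstar a x := by
  set D := ‖x - xstar‖ with hD
  have hD0 : 0 < D := norm_pos_iff.2 (sub_ne_zero.2 hx0)
  set w := D⁻¹ • (x - xstar) with hw
  have hw1 : ‖w‖ = 1 := by
    rw [hw, norm_smul, norm_inv, Real.norm_of_nonneg hD0.le, ← hD, inv_mul_cancel₀ hD0.ne']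
  have hxw : x = xstar + D • w := by
    rw [hw, smul_smul, mul_inv_cancel₀ hD0.ne']; simp
  have h := hP xstar w (hR ▸ hR1) (by rw [hR]; linarith) hw1
  calc p * D / R ^ 2 = D / R * (p / R) := by field_simp
    _ ≤ D / R * ((1 / m : ℝ) * ∑ i, psi ⟪a i, xstar⟫ (R * ⟪a i, w⟫)) := by gcongr
    _ = (1 / m : ℝ) * ∑ i, D / R * psi ⟪a i, xstar⟫ (R * ⟪a i, w⟫) := by
      rw [← Finset.mul_sum]; ring
    _ ≤ _ := by
      unfold loss
      refine mul_le_mul_of_nonneg_left (Finset.sum_le_sum fun i _ => ?_) (by positivity)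
      refine f_term hD0.le (by linarith) hx ?_
      conv_lhs => rw [hxw]
      rw [inner_add_right, real_inner_smul_right]

lemma aim_ge (xstar x : EuclideanSpace ℝ (Fin d)) (a : Fin m → EuclideanSpace ℝ (Fin d))
    {R p : ℝ} (hR : ‖xstar‖ = R) (hR1 : 1 ≤ R) (hx : ‖x - xstar‖ ≤ R) (hx0 : x ≠ xstar)
    (hP : ∀ z w : EuclideanSpace ℝ (Fin d), 1 ≤ ‖z‖ → ‖z‖ ≤ 2 * R → ‖w‖ = 1 →
      p / R ≤ (1 / m : ℝ) * ∑ i, psi ⟪a i, z⟫ (R * ⟪a i, w⟫)) :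
    p * ‖x - xstar‖ / R ^ 2 ≤ ⟪subgrad xstar a x, x - xstar⟫ := by
  set D := ‖x - xstar‖ with hD
  have hD0 : 0 < D := norm_pos_iff.2 (sub_ne_zero.2 hx0)
  set w := D⁻¹ • (x - xstar) with hw
  have hw1 : ‖w‖ = 1 := by
    rw [hw, norm_smul, norm_inv, Real.norm_of_nonneg hD0.le, ← hD, inv_mul_cancel₀ hD0.ne']
  have hxw : x = xstar + D • w := by
    rw [hw, smul_smul, mul_inv_cancel₀ hD0.ne']; simp
  have hR0 : 0 < R := by linarith
  obtain ⟨z, hz1, hz2, hz⟩ : ∃ z : EuclideanSpace ℝ (Fin d), 1 ≤ ‖z‖ ∧ ‖z‖ ≤ 2 * R ∧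
      ∀ i, D / R * psi ⟪a i, z⟫ (R * ⟪a i, w⟫) ≤ aTerm ⟪a i, xstar⟫ ⟪a i, x⟫ := by
    by_cases h0 : x = 0
    · have hDR : D = R := by rw [hD, h0]; simpa using hR
      refine ⟨R⁻¹ • xstar, ?_, ?_, fun i => ?_⟩
      · rw [norm_smul, norm_inv, Real.norm_of_nonneg hR0.le, hR, inv_mul_cancel₀ hR0.ne']
      · rw [norm_smul, norm_inv, Real.norm_of_nonneg hR0.le, hR, inv_mul_cancel₀ hR0.ne']; linarith
      · have := a_term0 (u := ⟪a i, xstar⟫) hR0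
        rw [hw, hDR, h0]
        simp only [real_inner_smul_right, zero_sub, inner_neg_right, inner_zero_right]
        convert this using 3
        · ring
        · ring
    · have hx0 : 0 < ‖x‖ := norm_pos_iff.2 h0
      set θ := (min 1 ‖x‖)⁻¹ with hθ
      have hmin : 0 < min 1 ‖x‖ := lt_min one_pos hx0
      have hθ1 : 1 ≤ θ := (one_le_inv₀ hmin).2 (min_le_left _ _)
      have hn : ‖θ • x‖ = ‖x‖ / min 1 ‖x‖ := by
        rw [norm_smul, Real.norm_of_nonneg (by linarith), hθ]; field_simp
      refine ⟨θ • x, ?_, ?_, fun i => ?_⟩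
      · rw [hn, one_le_div hmin]; exact min_le_right _ _
      · rw [hn, div_le_iff₀ hmin]
        have : ‖x‖ ≤ 2 * R := by
          calc ‖x‖ = ‖xstar + (x - xstar)‖ := by congr 1; abel
            _ ≤ ‖xstar‖ + ‖x - xstar‖ := norm_add_le _ _
            _ ≤ _ := by rw [hR]; linarith
        rcases le_total 1 ‖x‖ with h | h
        · rw [min_eq_left h]; linarith
        · rw [min_eq_right h]; nlinarith
      · refine a_term hD0.le hR0 hθ1 (by rw [real_inner_smul_right]) ?_
        conv_lhs => rw [hxw]
        rw [inner_add_right, real_inner_smul_right]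
  have h := hP z w hz1 hz2 hw1
  calc p * D / R ^ 2 = D / R * (p / R) := by field_simp
    _ ≤ D / R * ((1 / m : ℝ) * ∑ i, psi ⟪a i, z⟫ (R * ⟪a i, w⟫)) := by gcongr
    _ = (1 / m : ℝ) * ∑ i, D / R * psi ⟪a i, z⟫ (R * ⟪a i, w⟫) := by
      rw [← Finset.mul_sum]; ring
    _ ≤ (1 / m : ℝ) * ∑ i, aTerm ⟪a i, xstar⟫ ⟪a i, x⟫ :=
      mul_le_mul_of_nonneg_left (Finset.sum_le_sum fun i _ => hz i) (by positivity)
    _ = _ := by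
      rw [inner_subgrad]
      congr 1
      refine Finset.sum_congr rfl fun i _ => ?_
      unfold aTerm
      rw [inner_sub_right]; ring

lemma kappa_ge {R κ : ℝ} (hκ : κ = 8 * Real.sqrt π * (1 + 9 * π * R ^ 2)) :
    400 * R ^ 2 ≤ κ ∧ 1 ≤ κ := by
  have h1 : (3.1415 : ℝ) ≤ π := Real.pi_gt_d4.le
  have h2 : (1.772 : ℝ) ≤ Real.sqrt π := Real.le_sqrt_of_sq_le (by linarith)
  have h3 : 8 * 1.772 * (1 + 9 * 3.1415 * R ^ 2) ≤ κ := by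
    rw [hκ]; gcongr
  constructor <;> nlinarith [sq_nonneg R]

lemma step (xstar x : EuclideanSpace ℝ (Fin d)) (a : Fin m → EuclideanSpace ℝ (Fin d))
    {R κ η : ℝ} (hR : ‖xstar‖ = R) (hR1 : 1 ≤ R) (hx : ‖x - xstar‖ ≤ R)
    (hκ : κ = 8 * Real.sqrt π * (1 + 9 * π * R ^ 2)) (hη : 0 < η) (hη1 : η ≤ 1 / κ)
    (hS : ∀ w, (1 / m : ℝ) * ∑ i, |⟪a i, w⟫| ≤ 5 / 4 * ‖w‖)
    (hP : ∀ z w : EuclideanSpace ℝ (Fin d), 1 ≤ ‖z‖ → ‖z‖ ≤ 2 * R → ‖w‖ = 1 →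
      0.0032 / R ≤ (1 / m : ℝ) * ∑ i, psi ⟪a i, z⟫ (R * ⟪a i, w⟫)) :
    ‖(if subgrad xstar a x = 0 then x
      else x - (η * loss xstar a x / ‖subgrad xstar a x‖ ^ 2) • subgrad xstar a x) - xstar‖ ^ 2
      ≤ (1 - η / κ ^ 2) * ‖x - xstar‖ ^ 2 := by
  have hf0 := loss_nonneg xstar x a
  have hf1 := loss_le xstar x a hS
  by_cases hxx : x = xstar
  · have : loss xstar a x = 0 := by
      refine le_antisymm (hf1.trans ?_) hf0
      rw [hxx]; simp
    rw [this]; simp [hxx]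
  have hf2 := loss_ge xstar x a hR hR1 hx hxx hP
  have hA := aim_ge xstar x a hR hR1 hx hxx hP
  have hg := subgrad_norm_le xstar x a (by norm_num) hS
  obtain ⟨hk, hk1⟩ := kappa_ge hκ
  have hD0 : 0 < ‖x - xstar‖ := norm_pos_iff.2 (sub_ne_zero.2 hxx)
  set D := ‖x - xstar‖ with hD
  set f := loss xstar a x
  set g := subgrad xstar a x
  have hk0 : 0 < κ := by linarith
  have hq : 5 / 4 * D / κ ≤ 0.0032 * D / R ^ 2 := by
    rw [div_le_div_iff₀ hk0 (by positivity)]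
    nlinarith
  have hf3 := hq.trans hf2
  have hA3 := hq.trans hA
  have hq0 : 0 < 5 / 4 * D / κ := by positivity
  have hg0 : g ≠ 0 := by
    intro h
    rw [h, inner_zero_left] at hA3
    linarith
  rw [if_neg hg0]
  have hgn : 0 < ‖g‖ := norm_pos_iff.2 hg0
  have e1 : x - (η * f / ‖g‖ ^ 2) • g - xstar = (x - xstar) - (η * f / ‖g‖ ^ 2) • g := by abel
  rw [e1, norm_sub_sq_real, real_inner_smul_right, norm_smul, real_inner_comm, ← hD,
    Real.norm_of_nonneg (by positivity)]
  set A := ⟪g, x - xstar⟫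
  have e2 : η * f ≤ 5 / 4 * D / κ := by
    calc η * f ≤ 1 / κ * (5 / 4 * D) := by gcongr
      _ = _ := by ring
  have e3 : (5 / 4 * D / κ) * (5 / 4 * D / κ) ≤ f * (2 * A - η * f) :=
    mul_le_mul hf3 (by linarith) hq0.le hf0
  have e4 : D ^ 2 / κ ^ 2 ≤ f * (2 * A - η * f) / ‖g‖ ^ 2 := by
    rw [le_div_iff₀ (by positivity)]
    refine le_trans ?_ e3
    have : ‖g‖ ^ 2 ≤ (5 / 4) ^ 2 := by gcongr
    calc D ^ 2 / κ ^ 2 * ‖g‖ ^ 2 ≤ D ^ 2 / κ ^ 2 * (5 / 4) ^ 2 := by gcongr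
      _ = _ := by ring
  have e5 : D ^ 2 - 2 * (η * f / ‖g‖ ^ 2 * A) + (η * f / ‖g‖ ^ 2 * ‖g‖) ^ 2
      = D ^ 2 - η * (f * (2 * A - η * f) / ‖g‖ ^ 2) := by
    field_simp; ring
  rw [e5]
  calc _ ≤ D ^ 2 - η * (D ^ 2 / κ ^ 2) := by gcongr
    _ = _ := by ring

/-- the deterministic part -/
lemma determ (xstar : EuclideanSpace ℝ (Fin d)) (a : Fin m → EuclideanSpace ℝ (Fin d))
    {R κ η : ℝ} (hR : ‖xstar‖ = R) (hR1 : 1 ≤ R)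
    (hκ : κ = 8 * Real.sqrt π * (1 + 9 * π * R ^ 2)) (hη : 0 < η) (hη1 : η ≤ 1 / κ)
    (hS : ∀ w, (1 / m : ℝ) * ∑ i, |⟪a i, w⟫| ≤ 5 / 4 * ‖w‖)
    (hP : ∀ z w : EuclideanSpace ℝ (Fin d), 1 ≤ ‖z‖ → ‖z‖ ≤ 2 * R → ‖w‖ = 1 →
      0.0032 / R ≤ (1 / m : ℝ) * ∑ i, psi ⟪a i, z⟫ (R * ⟪a i, w⟫))
    (x : ℕ → EuclideanSpace ℝ (Fin d)) (hx0 : x 0 = 0)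
    (hx : ∀ k : ℕ, x (k + 1) =
                        if subgrad xstar a (x k) = 0 then x k
                        else x k - (η * loss xstar a (x k) / ‖subgrad xstar a (x k)‖ ^ 2) •
                          subgrad xstar a (x k)) (i : ℕ) :
    ‖x (i + 1) - xstar‖ ^ 2 ≤ (1 - η / κ ^ 2) * ‖x i - xstar‖ ^ 2 := by
  obtain ⟨hk, hk1⟩ := kappa_ge hκ
  have key : ∀ k, ‖x k - xstar‖ ≤ R →
      ‖x (k + 1) - xstar‖ ^ 2 ≤ (1 - η / κ ^ 2) * ‖x k - xstar‖ ^ 2 := by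
    intro k hk
    have := step xstar (x k) a hR hR1 hk hκ hη hη1 hS hP
    rw [← hx k] at this
    exact this
  have all : ∀ k, ‖x k - xstar‖ ≤ R := by
    intro k
    induction k with
    | zero => rw [hx0]; simp [hR]
    | succ k ih =>
      have h1 := key k ih
      have h2 : 0 ≤ η / κ ^ 2 := by positivity
      have h3 : ‖x (k + 1) - xstar‖ ^ 2 ≤ ‖x k - xstar‖ ^ 2 := by
        nlinarith [sq_nonneg ‖x k - xstar‖]
      exact (pow_le_pow_iff_left₀ (norm_nonneg _) (norm_nonneg _) two_ne_zero |>.1 h3).trans ih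
  exact key i (all i)

lemma rate {κ η : ℝ} (hκ : 1 ≤ κ) (hη : 0 < η) :
    1 - η / κ ^ 2 ≤ 1 - η / 5 * κ ^ ((-5 : ℝ) / 2) := by
  have h1 : κ ^ ((-5 : ℝ) / 2) ≤ κ ^ (-2 : ℝ) :=
    Real.rpow_le_rpow_of_exponent_le hκ (by norm_num)
  have h2 : κ ^ (-2 : ℝ) = 1 / κ ^ 2 := by
    rw [Real.rpow_neg (by linarith)]; norm_num
  have h3 : 0 ≤ κ ^ ((-5 : ℝ) / 2) := by positivity
  rw [h2] at h1
  have : η / κ ^ 2 = η * (1 / κ ^ 2) := by ring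
  rw [this]
  nlinarith

end PSGM
namespace PSGM

open Metric in
lemma sep_card {d : ℕ} (s : Finset (EuclideanSpace ℝ (Fin d))) {r ε : ℝ} (hr : 0 ≤ r) (hε : 0 < ε)
    (hs : ∀ c ∈ s, ‖c‖ ≤ r) (h : ∀ c ∈ s, ∀ e ∈ s, c ≠ e → ε ≤ ‖c - e‖) :
    (s.card : ℝ) ≤ (1 + 2 * r / ε) ^ d := by
  let μ : Measure (EuclideanSpace ℝ (Fin d)) := Measure.addHaar
  set δ : ℝ := ε / 2 with hδ
  have δpos : 0 < δ := by positivity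
  set ρ : ℝ := δ + r with hρ
  have ρpos : 0 < ρ := by positivity
  set A := ⋃ c ∈ s, ball (c : EuclideanSpace ℝ (Fin d)) δ with hA
  have D : Set.Pairwise (s : Set (EuclideanSpace ℝ (Fin d)))
      (Function.onFun Disjoint fun c => ball (c : EuclideanSpace ℝ (Fin d)) δ) := by
    rintro c hc e he hce
    apply ball_disjoint_ball
    rw [dist_eq_norm]
    have := h c hc e he hce
    rw [hδ]; linarith
  have A_subset : A ⊆ ball (0 : EuclideanSpace ℝ (Fin d)) ρ := by
    refine Set.iUnion₂_subset fun x hx => ?_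
    apply ball_subset_ball'
    rw [dist_zero_right]
    linarith [hs x hx]
  have I : (s.card : ℝ≥0∞) * ENNReal.ofReal (δ ^ d) * μ (ball 0 1) ≤
      ENNReal.ofReal (ρ ^ d) * μ (ball 0 1) :=
    calc
      (s.card : ℝ≥0∞) * ENNReal.ofReal (δ ^ d) * μ (ball 0 1) = μ A := by
        rw [hA, measure_biUnion_finset D fun c _ => measurableSet_ball]
        simp only [μ.addHaar_ball_of_pos _ δpos]
        simp only [Finset.sum_const, nsmul_eq_mul, mul_assoc, finrank_euclideanSpace_fin]
      _ ≤ μ (ball (0 : EuclideanSpace ℝ (Fin d)) ρ) := measure_mono A_subset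
      _ = ENNReal.ofReal (ρ ^ d) * μ (ball 0 1) := by
        simp only [μ.addHaar_ball_of_pos _ ρpos, finrank_euclideanSpace_fin]
  have J : (s.card : ℝ≥0∞) * ENNReal.ofReal (δ ^ d) ≤ ENNReal.ofReal (ρ ^ d) :=
    (ENNReal.mul_le_mul_iff_left (measure_ball_pos _ _ zero_lt_one).ne' measure_ball_lt_top.ne).1 I
  have K := ENNReal.toReal_le_of_le_ofReal (pow_nonneg ρpos.le _) J
  rw [ENNReal.toReal_mul, ENNReal.toReal_natCast, ENNReal.toReal_ofReal (by positivity)] at K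
  have e : (1 + 2 * r / ε) = ρ / δ := by rw [hρ, hδ]; field_simp
  rw [e, div_pow, le_div_iff₀ (by positivity)]
  exact K

lemma exists_net {d : ℕ} (A : Set (EuclideanSpace ℝ (Fin d))) {r ε : ℝ} (hr : 0 ≤ r) (hε : 0 < ε)
    (hA : ∀ c ∈ A, ‖c‖ ≤ r) : ∃ N : Finset (EuclideanSpace ℝ (Fin d)), (∀ c ∈ N, c ∈ A) ∧
      (N.card : ℝ) ≤ (1 + 2 * r / ε) ^ d ∧ ∀ x ∈ A, ∃ y ∈ N, ‖x - y‖ ≤ ε := by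
  by_contra hcon
  push Not at hcon
  have key : ∀ n : ℕ, ∃ s : Finset (EuclideanSpace ℝ (Fin d)), s.card = n ∧ (∀ c ∈ s, c ∈ A) ∧
      ∀ c ∈ s, ∀ e ∈ s, c ≠ e → ε ≤ ‖c - e‖ := by
    intro n
    induction n with
    | zero => exact ⟨∅, by simp⟩
    | succ n ih =>
      obtain ⟨s, hs, hsA, hsep⟩ := ih
      obtain ⟨x, hxA, hx⟩ := hcon s hsA (sep_card s hr hε (fun c hc => hA c (hsA c hc)) hsep)
      have hxs : x ∉ s := fun h => by
        have := hx x h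
        simp at this; linarith
      refine ⟨insert x s, by rw [Finset.card_insert_of_notMem hxs, hs], ?_, ?_⟩
      · intro c hc
        rcases Finset.mem_insert.1 hc with rfl | h
        · exact hxA
        · exact hsA c h
      · intro c hc e he hce
        rcases Finset.mem_insert.1 hc with rfl | h <;> rcases Finset.mem_insert.1 he with rfl | h'
        · exact absurd rfl hce
        · exact (hx e h').le
        · rw [norm_sub_rev]; exact (hx c h).le
        · exact hsep c h e h' hce
  obtain ⟨n, hn⟩ := exists_nat_gt ((1 + 2 * r / ε) ^ d)
  obtain ⟨s, hs, hsA, hsep⟩ := key n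
  have := sep_card s hr hε (fun c hc => hA c (hsA c hc)) hsep
  rw [hs] at this
  linarith

lemma std_eq (d : ℕ) : _root_.stdGaussian d = ProbabilityTheory.stdGaussian (EuclideanSpace ℝ (Fin d)) :=
  map_pi_eq_stdGaussian

instance std_prob (d : ℕ) : IsProbabilityMeasure (_root_.stdGaussian d) := by
  rw [std_eq]; infer_instance

instance iid_prob (d m : ℕ) : IsProbabilityMeasure (iidGaussian d m) := by
  unfold iidGaussian; infer_instance

/-- generic Chernoff bound -/
lemma chernoff {d m : ℕ} (φ : EuclideanSpace ℝ (Fin d) → ℝ) (hφ : Measurable φ) {b : ℝ}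
    (hb : ∫⁻ a, ENNReal.ofReal (Real.exp (φ a)) ∂(_root_.stdGaussian d) ≤ ENNReal.ofReal (Real.exp (-b))) :
    iidGaussian d m {a | 0 ≤ ∑ i, φ (a i)} ≤ ENNReal.ofReal (Real.exp (-(b * m))) := by
  have h1 : ∫⁻ a, ∏ i, ENNReal.ofReal (Real.exp (φ (a i))) ∂(iidGaussian d m) ≤
      ENNReal.ofReal (Real.exp (-(b * m))) := by
    have hind : iIndepFun (fun i (a : Fin m → EuclideanSpace ℝ (Fin d)) =>
        ENNReal.ofReal (Real.exp (φ (a i)))) (iidGaussian d m) := by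
      unfold iidGaussian
      exact iIndepFun_pi (X := fun i a => ENNReal.ofReal (Real.exp (φ a)))
        (fun i => by fun_prop)
    rw [lintegral_prod_eq_prod_lintegral_of_indepFun _ _ hind (fun i => by fun_prop)]
    calc _ ≤ ∏ i : Fin m, ENNReal.ofReal (Real.exp (-b)) := by
          refine Finset.prod_le_prod' fun i _ => ?_
          refine le_trans (le_of_eq ?_) hb
          have hmp := measurePreserving_eval (fun _ : Fin m => _root_.stdGaussian d) i
          exact hmp.lintegral_comp (f := fun a => ENNReal.ofReal (Real.exp (φ a))) (by fun_prop)
      _ = _ := by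
          rw [Finset.prod_const, ← ENNReal.ofReal_pow (Real.exp_pos _).le, ← Real.exp_nat_mul]
          simp; ring_nf
  refine le_trans ?_ h1
  have h2 := mul_meas_ge_le_lintegral (μ := iidGaussian d m)
    (f := fun a => ∏ i, ENNReal.ofReal (Real.exp (φ (a i)))) (by fun_prop) 1
  rw [one_mul] at h2
  refine le_trans (measure_mono ?_) h2
  intro a ha
  simp only [Set.mem_ofPred_eq] at ha ⊢
  rw [← ENNReal.ofReal_prod_of_nonneg (fun i _ => (Real.exp_pos _).le), ← Real.exp_sum]
  rw [← ENNReal.ofReal_one]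
  exact ENNReal.ofReal_le_ofReal (Real.one_le_exp ha)

lemma lower_tail {d m : ℕ} (X : EuclideanSpace ℝ (Fin d) → ℝ) (hX : Measurable X)
    (h0 : ∀ a, 0 ≤ X a) (h1 : ∀ a, X a ≤ 1) {p t : ℝ} (ht : 0 ≤ t)
    (hp : p ≤ ∫ a, X a ∂(_root_.stdGaussian d)) :
    iidGaussian d m {a | ∑ i, X (a i) ≤ m * (p - t)} ≤ ENNReal.ofReal (Real.exp (-(t ^ 2 / 2 * m))) := by
  have hint : Integrable X (_root_.stdGaussian d) :=
    Integrable.of_bound hX.aestronglyMeasurable 1 (ae_of_all _ fun a => by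
      rw [Real.norm_of_nonneg (h0 a)]; exact h1 a)
  rcases ht.eq_or_lt with rfl | ht
  · simp only [ne_eq, OfNat.ofNat_ne_zero, not_false_eq_true, zero_pow, zero_div, zero_mul, neg_zero,
      Real.exp_zero, ENNReal.ofReal_one]
    exact prob_le_one
  have hexp : ∀ a, Real.exp (t * (p - t - X a)) ≤
      Real.exp (t * (p - t)) * (1 - t * X a + t ^ 2 / 2) := by
    intro a
    rw [show t * (p - t - X a) = t * (p - t) + -(t * X a) by ring, Real.exp_add]
    refine mul_le_mul_of_nonneg_left ?_ (Real.exp_pos _).le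
    have hy : 0 ≤ t * X a := mul_nonneg ht.le (h0 a)
    have h2 : Real.exp (-(t * X a)) ≤ 1 - t * X a + (t * X a) ^ 2 / 2 := by
      have h3 := Real.quadratic_le_exp_of_nonneg hy
      rw [Real.exp_neg, inv_le_iff_one_le_mul₀ (Real.exp_pos _)]
      have : 0 ≤ 1 - t * X a + (t * X a) ^ 2 / 2 := by nlinarith [sq_nonneg (t * X a - 1)]
      nlinarith [mul_le_mul_of_nonneg_left h3 this, sq_nonneg ((t * X a) ^ 2)]
    have : (t * X a) ^ 2 ≤ t ^ 2 := by
      rw [mul_pow]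
      have : X a ^ 2 ≤ 1 := pow_le_one₀ (h0 a) (h1 a)
      nlinarith [sq_nonneg t]
    linarith
  have := chernoff (m := m) (fun a => t * (p - t - X a)) (by fun_prop) (b := t ^ 2 / 2) (by
    have hi : Integrable (fun a => Real.exp (t * (p - t)) * (1 - t * X a + t ^ 2 / 2))
      (_root_.stdGaussian d) := by
      refine Integrable.const_mul ?_ _
      exact ((integrable_const _).sub (hint.const_mul _)).add (integrable_const _)
    calc _ ≤ ∫⁻ a, ENNReal.ofReal (Real.exp (t * (p - t)) * (1 - t * X a + t ^ 2 / 2))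
            ∂(_root_.stdGaussian d) := by
          refine lintegral_mono fun a => ENNReal.ofReal_le_ofReal (hexp a)
      _ = ENNReal.ofReal (∫ a, Real.exp (t * (p - t)) * (1 - t * X a + t ^ 2 / 2)
            ∂(_root_.stdGaussian d)) := by
          rw [ofReal_integral_eq_lintegral_ofReal hi (ae_of_all _ fun a =>
            (Real.exp_pos _).le.trans (hexp a))]
      _ ≤ _ := by
          refine ENNReal.ofReal_le_ofReal ?_
          have hs : Integrable (fun a => 1 - t * X a) (_root_.stdGaussian d) :=
            (integrable_const _).sub (hint.const_mul _)
          rw [integral_const_mul, integral_add hs (integrable_const _), integral_sub (integrable_const _) (hint.const_mul _),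
            integral_const_mul]
          simp only [integral_const, probReal_univ, one_smul]
          set E := ∫ a, X a ∂(_root_.stdGaussian d)
          have h4 : 1 - t * E + t ^ 2 / 2 ≤ Real.exp (-(t * p) + t ^ 2 / 2) := by
            have := Real.add_one_le_exp (-(t * p) + t ^ 2 / 2)
            nlinarith
          calc _ ≤ Real.exp (t * (p - t)) * Real.exp (-(t * p) + t ^ 2 / 2) := by gcongr
            _ = _ := by rw [← Real.exp_add]; ring_nf)
  refine le_trans (measure_mono ?_) this
  intro a ha
  simp only [Set.mem_ofPred_eq] at ha ⊢
  rw [← Finset.mul_sum, Finset.sum_sub_distrib]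
  simp only [Finset.sum_const, Finset.card_univ, Fintype.card_fin, nsmul_eq_mul]
  exact mul_nonneg ht.le (by linarith)

end PSGM
namespace PSGM

lemma charProd (A B : ℝ) :
    ∫ p : ℝ × ℝ, Complex.exp (((A * p.1 + B * p.2 : ℝ) : ℂ) * Complex.I)
      ∂((gaussianReal 0 1).prod (gaussianReal 0 1)) = Complex.exp (-((A^2+B^2 : ℝ) : ℂ)/2) := by
  have h : ∀ p : ℝ × ℝ, Complex.exp (((A * p.1 + B * p.2 : ℝ) : ℂ) * Complex.I) =
      Complex.exp ((A : ℂ) * p.1 * Complex.I) * Complex.exp ((B:ℂ) * p.2 * Complex.I) := by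
    intro p; rw [← Complex.exp_add]; push_cast; ring_nf
  simp_rw [h]
  rw [integral_prod_mul (fun x : ℝ => Complex.exp ((A : ℂ) * x * Complex.I))
    (fun x : ℝ => Complex.exp ((B : ℂ) * x * Complex.I)), ← charFun_apply_real, ← charFun_apply_real,
    charFun_gaussianReal, charFun_gaussianReal, ← Complex.exp_add]
  push_cast; congr 1; ring

lemma pair_law {d : ℕ} (z w : EuclideanSpace ℝ (Fin d)) {σ ρ τ : ℝ} (hz : ‖z‖ = σ) (hw : ‖w‖ = 1)
    (hρ : ⟪z, w⟫ = σ * ρ) (hτ : ρ^2 + τ^2 = 1) :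
    (_root_.stdGaussian d).map (fun a => (⟪a, z⟫, ⟪a, w⟫)) =
    ((gaussianReal 0 1).prod (gaussianReal 0 1)).map
      (fun p : ℝ × ℝ => (σ * p.1, ρ * p.1 + τ * p.2)) := by
  have m1 : Measurable (fun a : EuclideanSpace ℝ (Fin d) => (⟪a, z⟫, ⟪a, w⟫)) := by fun_prop
  have m2 : Measurable (fun p : ℝ × ℝ => (σ * p.1, ρ * p.1 + τ * p.2)) := by fun_prop
  have := Measure.isProbabilityMeasure_map (μ := _root_.stdGaussian d) m1.aemeasurable
  have := Measure.isProbabilityMeasure_map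
    (μ := (gaussianReal 0 1).prod (gaussianReal 0 1)) m2.aemeasurable
  apply Measure.ext_of_charFunDual
  ext L
  obtain ⟨α, β, hL⟩ : ∃ α β : ℝ, ∀ x y : ℝ, L (x, y) = x * α + y * β := by
    refine ⟨L (1, 0), L (0, 1), fun x y => ?_⟩
    have : ((x, y) : ℝ × ℝ) = x • (1, 0) + y • (0, 1) := by simp
    rw [this, map_add, map_smul, map_smul]; simp
  have mL : Measurable fun v : ℝ × ℝ => Complex.exp ((L v : ℂ) * Complex.I) := by
    have : Continuous fun v : ℝ × ℝ => Complex.exp ((L v : ℂ) * Complex.I) := by fun_prop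
    exact this.measurable
  rw [charFunDual_apply, charFunDual_apply, integral_map m1.aemeasurable mL.aestronglyMeasurable,
    integral_map m2.aemeasurable mL.aestronglyMeasurable]
  simp_rw [hL]
  have e1 : ∀ a : EuclideanSpace ℝ (Fin d), ⟪a, z⟫ * α + ⟪a, w⟫ * β = ⟪a, α • z + β • w⟫ := by
    intro a; rw [inner_add_right, inner_smul_right, inner_smul_right]; ring
  have e2 : ∀ p : ℝ × ℝ, σ * p.1 * α + (ρ * p.1 + τ * p.2) * β
      = (σ * α + ρ * β) * p.1 + (τ * β) * p.2 := by intro p; ring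
  simp_rw [e1, e2]
  rw [charProd, ← charFun_apply, std_eq, charFun_stdGaussian]
  congr 2
  have : ‖α • z + β • w‖^2 = (σ * α + ρ * β)^2 + (τ*β)^2 := by
    rw [norm_add_sq_real, norm_smul, norm_smul, hz, hw, inner_smul_left, inner_smul_right, hρ,
      mul_pow, mul_pow, Real.norm_eq_abs, Real.norm_eq_abs, sq_abs, sq_abs]
    simp
    linear_combination (-β^2) * hτ
  rw [← this]; push_cast; rfl

lemma one_law {d : ℕ} (w : EuclideanSpace ℝ (Fin d)) (hw : ‖w‖ = 1) :
    (_root_.stdGaussian d).map (fun a => ⟪a, w⟫) = gaussianReal 0 1 := by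
  have m1 : Measurable (fun a : EuclideanSpace ℝ (Fin d) => ⟪a, w⟫) := by fun_prop
  have := Measure.isProbabilityMeasure_map (μ := _root_.stdGaussian d) m1.aemeasurable
  apply Measure.ext_of_charFun
  ext t
  have mL : Measurable fun v : ℝ => Complex.exp ((t * v : ℂ) * Complex.I) := by fun_prop
  rw [charFun_apply_real, integral_map m1.aemeasurable mL.aestronglyMeasurable,
    charFun_gaussianReal]
  have : ∀ a : EuclideanSpace ℝ (Fin d), (t:ℂ) * (⟪a, w⟫ : ℝ) = ((⟪a, t • w⟫ : ℝ) : ℂ) := by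
    intro a; rw [inner_smul_right]; push_cast; rfl
  simp_rw [this]
  rw [← charFun_apply, std_eq, charFun_stdGaussian, norm_smul, hw]
  congr 1
  have : (‖t‖ * 1)^2 = t^2 := by simp
  rw [← Complex.ofReal_pow, this]; push_cast; ring

/-- upper tail -/
lemma upper_tail {d m : ℕ} (w : EuclideanSpace ℝ (Fin d)) (hw : ‖w‖ = 1) :
    iidGaussian d m {a | (m : ℝ) * 1.2 ≤ ∑ i, |⟪a i, w⟫|} ≤ ENNReal.ofReal (exp (-(0.02 * m))) := by
  have key := chernoff (d := d) (m := m) (fun a => 1.2 * (|⟪a, w⟫| - 1.2)) (by fun_prop) (b := 0.02) ?_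
  · refine le_trans (measure_mono ?_) key
    intro a ha
    simp only [Set.mem_ofPred_eq] at ha ⊢
    rw [← Finset.mul_sum, Finset.sum_sub_distrib]
    simp
    linarith
  · have m1 : Measurable (fun a : EuclideanSpace ℝ (Fin d) => ⟪a, w⟫) := by fun_prop
    have : ∫⁻ a, ENNReal.ofReal (exp (1.2 * (|⟪a, w⟫| - 1.2))) ∂_root_.stdGaussian d
        = ∫⁻ x, ENNReal.ofReal (exp (1.2 * (|x| - 1.2))) ∂(gaussianReal 0 1) := by
      rw [← one_law w hw, lintegral_map (by fun_prop) m1]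
    rw [this]
    have i1 : ∀ c : ℝ, ∫⁻ x, ENNReal.ofReal (exp (c * x)) ∂(gaussianReal 0 1) = ENNReal.ofReal (exp (c^2/2)) := by
      intro c
      rw [← ofReal_integral_eq_lintegral_ofReal (integrable_exp_mul_gaussianReal c)
        (Filter.Eventually.of_forall fun x => (exp_pos _).le)]
      have := congrFun (mgf_id_gaussianReal (μ := 0) (v := 1)) c
      simp only [mgf, id] at this
      rw [this]; simp
    calc ∫⁻ x, ENNReal.ofReal (exp (1.2 * (|x| - 1.2))) ∂(gaussianReal 0 1)
        ≤ ∫⁻ x, ENNReal.ofReal (exp (-1.44)) * (ENNReal.ofReal (exp (1.2 * x)) +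
            ENNReal.ofReal (exp (-1.2 * x))) ∂(gaussianReal 0 1) := by
          apply lintegral_mono
          intro x
          simp only
          rw [← ENNReal.ofReal_add (exp_pos _).le (exp_pos _).le, ← ENNReal.ofReal_mul (exp_pos _).le]
          apply ENNReal.ofReal_le_ofReal
          have : (1.2:ℝ) * (|x| - 1.2) = -1.44 + 1.2 * |x| := by ring
          rw [this, exp_add]
          apply mul_le_mul_of_nonneg_left _ (exp_pos _).le
          rcases abs_cases x with ⟨h, _⟩ | ⟨h, _⟩ <;> rw [h]
          · linarith [exp_pos (-1.2 * x)]
          · have := exp_pos (1.2 * x)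
            rw [show (1.2:ℝ) * -x = -1.2 * x by ring]; linarith
      _ = ENNReal.ofReal (exp (-1.44) * (exp (0.72) + exp (0.72))) := by
          rw [lintegral_const_mul _ (by fun_prop), lintegral_add_left (by fun_prop), i1, i1,
            ← ENNReal.ofReal_add (exp_pos _).le (exp_pos _).le, ← ENNReal.ofReal_mul (exp_pos _).le]
          norm_num
      _ ≤ _ := by
          apply ENNReal.ofReal_le_ofReal
          have h2 : exp (-1.44) * (exp 0.72 + exp 0.72) = exp (log 2 - 0.72) := by
            rw [exp_sub, exp_log (by norm_num), ← two_mul, mul_left_comm, ← exp_add, div_eq_mul_inv, ← exp_neg]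
            norm_num
          rw [h2]
          apply exp_le_exp.2
          have := Real.log_two_lt_d9
          linarith
end PSGM
namespace PSGM

lemma sqrt_bounds : (0.398 : ℝ) ≤ (√(2 * π * 1))⁻¹ ∧ (√(2 * π * 1))⁻¹ ≤ (0.4 : ℝ) := by
  have h1 := Real.pi_gt_d4
  have h2 := Real.pi_lt_d4
  have a1 : √(2 * π * 1) ≤ 2.512 := Real.sqrt_le_iff.2 ⟨by norm_num, by nlinarith⟩
  have a2 : 2.5 ≤ √(2 * π * 1) := Real.le_sqrt_of_sq_le (by nlinarith)
  constructor
  · rw [le_inv_comm₀ (by norm_num) (by linarith)]; refine a1.trans (by norm_num)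
  · rw [inv_le_comm₀ (by linarith) (by norm_num)]; refine le_trans (by norm_num) a2

lemma gauss_Ico {a b : ℝ} (ha : 0 ≤ a) (hab : a ≤ b) :
    ENNReal.ofReal ((b - a) * (0.398 * exp (-b^2/2))) ≤ gaussianReal 0 1 (Set.Ico a b) := by
  rw [gaussianReal_apply _ (by norm_num)]
  calc ENNReal.ofReal ((b - a) * (0.398 * exp (-b^2/2)))
      = ∫⁻ x in Set.Ico a b, ENNReal.ofReal (0.398 * exp (-b^2/2)) := by
        rw [setLIntegral_const, Real.volume_Ico, ← ENNReal.ofReal_mul (by positivity)]; ring_nf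
    _ ≤ _ := by
        apply setLIntegral_mono (by fun_prop)
        intro x hx
        rw [gaussianPDF]
        apply ENNReal.ofReal_le_ofReal
        rw [gaussianPDFReal]
        simp only [NNReal.coe_one, sub_zero]
        apply mul_le_mul sqrt_bounds.1 _ (exp_pos _).le (le_trans (by norm_num) sqrt_bounds.1)
        apply exp_le_exp.2
        have := hx.1; have := hx.2
        nlinarith

lemma gauss_Ico_le {a b : ℝ} (hab : a ≤ b) :
    gaussianReal 0 1 (Set.Ico a b) ≤ ENNReal.ofReal (0.4 * (b - a)) := by
  rw [gaussianReal_apply _ (by norm_num)]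
  calc _ ≤ ∫⁻ x in Set.Ico a b, ENNReal.ofReal 0.4 := by
        apply setLIntegral_mono (by fun_prop)
        intro x hx
        rw [gaussianPDF]
        apply ENNReal.ofReal_le_ofReal
        rw [gaussianPDFReal]
        simp only [NNReal.coe_one, sub_zero]
        have : exp (-x^2/(2*1)) ≤ 1 := exp_le_one_iff.2 (by nlinarith [sq_nonneg x])
        have := sqrt_bounds.2
        have := sqrt_bounds.1
        nlinarith [exp_pos (-x^2/(2*1))]
    _ = _ := by rw [setLIntegral_const, Real.volume_Ico, ← ENNReal.ofReal_mul (by norm_num)]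

lemma gauss_Ici {c : ℝ} (hc : 0 ≤ c) :
    1/2 - 0.4 * c ≤ (gaussianReal 0 1).real (Set.Ici c) := by
  have hneg : (gaussianReal 0 1).real (Set.Iic 0) = (gaussianReal 0 1).real (Set.Ici 0) := by
    have h := gaussianReal_map_neg (μ := 0) (v := 1)
    rw [neg_zero] at h
    conv_lhs => rw [← h]
    rw [map_measureReal_apply (by fun_prop) measurableSet_Iic]
    congr 1
    ext x; simp
  have h1 : (1 : ℝ) ≤ (gaussianReal 0 1).real (Set.Iic 0) + (gaussianReal 0 1).real (Set.Ici 0) := by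
    have := measureReal_union_le (μ := gaussianReal 0 1) (Set.Iic 0) (Set.Ici 0)
    rwa [Set.Iic_union_Ici, probReal_univ] at this
  have h2 : (gaussianReal 0 1).real (Set.Ici 0) ≤ (gaussianReal 0 1).real (Set.Ico 0 c) +
      (gaussianReal 0 1).real (Set.Ici c) := by
    have := measureReal_union_le (μ := gaussianReal 0 1) (Set.Ico 0 c) (Set.Ici c)
    rwa [Set.Ico_union_Ici_eq_Ici hc] at this
  have h3 : (gaussianReal 0 1).real (Set.Ico 0 c) ≤ 0.4 * c := by
    have := gauss_Ico_le hc
    rw [sub_zero] at this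
    exact ENNReal.toReal_le_of_le_ofReal (by positivity) this
  linarith

/-- the event -/
def ev (σ lo hi : ℝ) : Set (ℝ × ℝ) := Set.Ico (lo/σ) (hi/σ) ×ˢ Set.Ici (lo/2)

lemma ev_meas (σ lo hi : ℝ) : MeasurableSet (ev σ lo hi) := measurableSet_Ico.prod measurableSet_Ici

lemma ev_prob {σ R lo hi : ℝ} (hσ : 1 ≤ σ) (hσR : σ ≤ 2 * R) (hlo : 0 ≤ lo) (hlo1 : lo ≤ 1)
    (hhi : hi = lo + 0.25) :
    (0.125 / R) * (0.398 * exp (-hi^2/2)) * (0.5 - 0.2 * lo) ≤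
     ((gaussianReal 0 1).prod (gaussianReal 0 1)).real (ev σ lo hi) := by
  have hσ0 : 0 < σ := by linarith
  have hR0 : 0 < R := by linarith
  unfold ev
  rw [measureReal_prod_prod]
  have h1 : (0.125 / R) * (0.398 * exp (-hi^2/2)) ≤ (gaussianReal 0 1).real (Set.Ico (lo/σ) (hi/σ)) := by
    have := gauss_Ico (a := lo/σ) (b := hi/σ) (by positivity) (by gcongr; linarith)
    have := (ENNReal.ofReal_le_iff_le_toReal (measure_ne_top _ _)).1 this
    refine le_trans ?_ this
    apply mul_le_mul
    · rw [← sub_div, div_le_div_iff₀ hR0 hσ0, hhi]; nlinarith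
    · apply mul_le_mul_of_nonneg_left _ (by norm_num)
      apply exp_le_exp.2
      have : hi/σ ≤ hi := div_le_self (by linarith) hσ
      have : 0 ≤ hi/σ := by have : 0 ≤ hi := by linarith
                            positivity
      nlinarith
    · positivity
    · rw [← sub_div]; apply div_nonneg _ hσ0.le; linarith
  have h2 := gauss_Ici (c := lo/2) (by positivity)
  apply mul_le_mul h1 _ (by linarith) measureReal_nonneg
  linarith

lemma psi_ev {σ R ρ τ lo hi : ℝ} (hσ : 1 ≤ σ) (hσR : σ ≤ 2 * R) (hR : 1 ≤ R) (hρ : 0 ≤ ρ) (hτ : 0 ≤ τ)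
    (hρτ : ρ^2 + τ^2 = 1) (hlo : 0 ≤ lo) {p : ℝ × ℝ} (hp : p ∈ ev σ lo hi) :
    exp (-hi) * (1 - exp (-(lo/2))) ≤ psi (σ * p.1) (R * (ρ * p.1 + τ * p.2)) := by
  have hσ0 : 0 < σ := by linarith
  obtain ⟨⟨h1, h2⟩, h3⟩ := hp
  rw [div_le_iff₀ hσ0] at h1
  rw [lt_div_iff₀ hσ0] at h2
  simp only [Set.mem_Ici] at h3
  have hp1 : 0 ≤ p.1 := by
    by_contra h; push Not at h; nlinarith
  have hs : 1 ≤ ρ + τ := by nlinarith [mul_nonneg hρ hτ]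
  have hRp : lo/2 ≤ R * p.1 := by nlinarith
  have hRp2 : lo/2 ≤ R * p.2 := by nlinarith
  have ht : lo/2 ≤ R * (ρ * p.1 + τ * p.2) := by
    have a1 := mul_le_mul_of_nonneg_left hRp hρ
    have a2 := mul_le_mul_of_nonneg_left hRp2 hτ
    nlinarith
  unfold psi
  have hz : max (σ * p.1) 0 = σ * p.1 := max_eq_left (by positivity)
  rw [hz]
  have hn : 0 ≤ 1 - exp (-(lo/2)) := by
    have : exp (-(lo/2)) ≤ 1 := exp_le_one_iff.2 (by linarith)
    linarith
  apply mul_le_mul _ _ hn (exp_pos _).le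
  · apply exp_le_exp.2; linarith
  · apply le_min
    · have : exp (-|R * (ρ * p.1 + τ * p.2)|) ≤ exp (-(lo/2)) := by
        apply exp_le_exp.2
        have := le_abs_self (R * (ρ * p.1 + τ * p.2))
        linarith
      linarith
    · have := add_one_le_exp (-(lo/2)); linarith

lemma nexp {x lo : ℝ} (n : ℕ) (hn : 0 < n) (h1 : 0 ≤ x) (h2 : x ≤ 1) (hlo : 0 < lo)
    (h : (∑ i ∈ Finset.range n, x^i / (Nat.factorial i)) + x^n * (n+1)/(Nat.factorial n * n) ≤ 1/lo) :
    lo ≤ exp (-x) := by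
  have := (Real.exp_bound' h1 h2 hn).trans h
  rw [exp_neg, le_inv_comm₀ hlo (exp_pos _)]
  simpa using this

lemma nexp' {x hi : ℝ} (n : ℕ) (h1 : 0 ≤ x) (hhi : 0 < hi)
    (h : 1/hi ≤ (∑ i ∈ Finset.range n, x^i / (Nat.factorial i))) :
    exp (-x) ≤ hi := by
  have := h.trans (Real.sum_le_exp_of_nonneg h1 n)
  rw [exp_neg, inv_le_comm₀ (exp_pos _) hhi]
  simpa using this

lemma numerics : (0.004 : ℝ) ≤ 0.125 * 0.398 * (
    exp (-0.5) * (1 - exp (-(0.25/2))) * (exp (-0.5^2/2) * (0.5 - 0.2 * 0.25)) +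
    exp (-0.75) * (1 - exp (-(0.5/2))) * (exp (-0.75^2/2) * (0.5 - 0.2 * 0.5)) +
    exp (-1) * (1 - exp (-(0.75/2))) * (exp (-1^2/2) * (0.5 - 0.2 * 0.75))) := by
  have a1 : (0.535:ℝ) ≤ exp (-0.5) * exp (-0.5^2/2) := by
    rw [← exp_add, show (-0.5 + -0.5^2/2 : ℝ) = -(0.625) by norm_num]
    exact nexp 5 (by norm_num) (by norm_num) (by norm_num) (by norm_num)
      (by norm_num [Finset.sum_range_succ, Nat.factorial])
  have a2 : (0.356:ℝ) ≤ exp (-0.75) * exp (-0.75^2/2) := by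
    have : (0.597:ℝ) ≤ exp (-(0.515625)) := nexp 5 (by norm_num) (by norm_num) (by norm_num) (by norm_num)
      (by norm_num [Finset.sum_range_succ, Nat.factorial])
    rw [← exp_add, show (-0.75 + -0.75^2/2 : ℝ) = -(0.515625) + -0.515625 by norm_num, exp_add]
    nlinarith
  have a3 : (0.223:ℝ) ≤ exp (-1) * exp (-1^2/2) := by
    have : (0.47223:ℝ) ≤ exp (-(0.75)) := nexp 6 (by norm_num) (by norm_num) (by norm_num) (by norm_num)
      (by norm_num [Finset.sum_range_succ, Nat.factorial])
    rw [← exp_add, show (-1 + -1^2/2 : ℝ) = -(0.75) + -0.75 by norm_num, exp_add]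
    nlinarith
  have b1 : exp (-(0.25/2)) ≤ (0.8825:ℝ) := nexp' 5 (by norm_num) (by norm_num)
      (by norm_num [Finset.sum_range_succ, Nat.factorial])
  have b2 : exp (-(0.5/2)) ≤ (0.7789:ℝ) := nexp' 5 (by norm_num) (by norm_num)
      (by norm_num [Finset.sum_range_succ, Nat.factorial])
  have b3 : exp (-(0.75/2)) ≤ (0.6874:ℝ) := nexp' 6 (by norm_num) (by norm_num)
      (by norm_num [Finset.sum_range_succ, Nat.factorial])
  have c1 : (0.535:ℝ) * 0.1175 ≤ (exp (-0.5) * exp (-0.5^2/2)) * (1 - exp (-(0.25/2))) :=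
    mul_le_mul a1 (by linarith) (by norm_num) (by positivity)
  have c2 : (0.356:ℝ) * 0.2211 ≤ (exp (-0.75) * exp (-0.75^2/2)) * (1 - exp (-(0.5/2))) :=
    mul_le_mul a2 (by linarith) (by norm_num) (by positivity)
  have c3 : (0.223:ℝ) * 0.3126 ≤ (exp (-1) * exp (-1^2/2)) * (1 - exp (-(0.75/2))) :=
    mul_le_mul a3 (by linarith) (by norm_num) (by positivity)
  linarith

lemma expect_prod {σ R ρ τ : ℝ} (hσ : 1 ≤ σ) (hσR : σ ≤ 2 * R) (hR : 1 ≤ R) (hρ : 0 ≤ ρ) (hτ : 0 ≤ τ)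
    (hρτ : ρ^2 + τ^2 = 1) :
    0.004 / R ≤ ∫ p : ℝ × ℝ, psi (σ * p.1) (R * (ρ * p.1 + τ * p.2))
      ∂((gaussianReal 0 1).prod (gaussianReal 0 1)) := by
  have hσ0 : 0 < σ := by linarith
  set P := (gaussianReal 0 1).prod (gaussianReal 0 1) with hP
  set c : ℝ → ℝ → ℝ := fun lo hi => exp (-hi) * (1 - exp (-(lo/2))) with hc
  set X : ℝ → ℝ → ℝ × ℝ → ℝ := fun lo hi => (ev σ lo hi).indicator (fun _ => c lo hi) with hX
  have hXint : ∀ lo hi, ∫ p, X lo hi p ∂P = P.real (ev σ lo hi) * c lo hi := by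
    intro lo hi
    rw [integral_indicator_const _ (ev_meas _ _ _)]; rfl
  have hXi : ∀ lo hi, Integrable (X lo hi) P := by
    intro lo hi
    exact (integrable_const _).indicator (ev_meas _ _ _)
  have hpsi : Integrable (fun p : ℝ × ℝ => psi (σ * p.1) (R * (ρ * p.1 + τ * p.2))) P := by
    have hcont : Continuous (fun p : ℝ × ℝ => psi (σ * p.1) (R * (ρ * p.1 + τ * p.2))) :=
      psi_cont.comp (by fun_prop : Continuous fun p : ℝ × ℝ => (σ * p.1, R * (ρ * p.1 + τ * p.2)))
    refine Integrable.of_bound hcont.aestronglyMeasurable 1 (Filter.Eventually.of_forall fun p => ?_)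
    rw [Real.norm_eq_abs, abs_of_nonneg (psi_nonneg _ _)]
    exact psi_le_one _ _
  have hle : ∫ p, (X 0.25 0.5 p + X 0.5 0.75 p + X 0.75 1 p) ∂P ≤
      ∫ p, psi (σ * p.1) (R * (ρ * p.1 + τ * p.2)) ∂P := by
    apply integral_mono (((hXi _ _).add (hXi _ _)).add (hXi _ _)) hpsi
    intro p
    have n0 := psi_nonneg (σ * p.1) (R * (ρ * p.1 + τ * p.2))
    have hb : ∀ lo hi, p ∈ ev σ lo hi → lo ≤ p.1 * σ ∧ p.1 * σ < hi := by
      rintro lo hi ⟨⟨h1, h2⟩, -⟩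
      exact ⟨(div_le_iff₀ hσ0).1 h1, (lt_div_iff₀ hσ0).1 h2⟩
    simp only [hX, Pi.add_apply]
    by_cases e1 : p ∈ ev σ 0.25 0.5
    · have e2 : p ∉ ev σ 0.5 0.75 := fun h => by linarith [(hb _ _ h).1, (hb _ _ e1).2]
      have e3 : p ∉ ev σ 0.75 1 := fun h => by linarith [(hb _ _ h).1, (hb _ _ e1).2]
      rw [Set.indicator_of_mem e1, Set.indicator_of_notMem e2, Set.indicator_of_notMem e3, add_zero, add_zero]
      exact psi_ev hσ hσR hR hρ hτ hρτ (by norm_num) e1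
    · by_cases e2 : p ∈ ev σ 0.5 0.75
      · have e3 : p ∉ ev σ 0.75 1 := fun h => by linarith [(hb _ _ h).1, (hb _ _ e2).2]
        rw [Set.indicator_of_notMem e1, Set.indicator_of_mem e2, Set.indicator_of_notMem e3, add_zero, zero_add]
        exact psi_ev hσ hσR hR hρ hτ hρτ (by norm_num) e2
      · rw [Set.indicator_of_notMem e1, Set.indicator_of_notMem e2, add_zero, zero_add]
        by_cases e3 : p ∈ ev σ 0.75 1
        · rw [Set.indicator_of_mem e3]
          exact psi_ev hσ hσR hR hρ hτ hρτ (by norm_num) e3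
        · rw [Set.indicator_of_notMem e3]; exact n0
  refine le_trans ?_ hle
  rw [integral_add (f := fun p => X 0.25 0.5 p + X 0.5 0.75 p) ((hXi _ _).add (hXi _ _)) (hXi _ _), integral_add (hXi _ _) (hXi _ _), hXint, hXint, hXint]
  have c0 : ∀ lo hi, 0 ≤ lo → 0 ≤ c lo hi := by
    intro lo hi h
    have : exp (-(lo/2)) ≤ 1 := exp_le_one_iff.2 (by linarith)
    exact mul_nonneg (exp_pos _).le (by linarith)
  have p1 := mul_le_mul_of_nonneg_right (ev_prob (lo := 0.25) (hi := 0.5) hσ hσR (by norm_num) (by norm_num) (by norm_num)) (c0 0.25 0.5 (by norm_num))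
  have p2 := mul_le_mul_of_nonneg_right (ev_prob (lo := 0.5) (hi := 0.75) hσ hσR (by norm_num) (by norm_num) (by norm_num)) (c0 0.5 0.75 (by norm_num))
  have p3 := mul_le_mul_of_nonneg_right (ev_prob (lo := 0.75) (hi := 1) hσ hσR (by norm_num) (by norm_num) (by norm_num)) (c0 0.75 1 (by norm_num))
  refine le_trans ?_ (add_le_add (add_le_add p1 p2) p3)
  have := div_le_div_of_nonneg_right numerics (by linarith : 0 ≤ R)
  refine this.trans (le_of_eq ?_)
  simp only [hc]
  ring

lemma expect_aux {d : ℕ} (z w : EuclideanSpace ℝ (Fin d)) {R : ℝ} (hR : 1 ≤ R) (hz : 1 ≤ ‖z‖)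
    (hz2 : ‖z‖ ≤ 2 * R) (hw : ‖w‖ = 1) (hzw : 0 ≤ ⟪z, w⟫) :
    0.004 / R ≤ ∫ a, psi ⟪a, z⟫ (R * ⟪a, w⟫) ∂_root_.stdGaussian d := by
  have hz0 : 0 < ‖z‖ := by linarith
  set ρ := ⟪z, w⟫ / ‖z‖ with hρ
  have h0 : 0 ≤ ρ := by positivity
  have h1 : ρ ≤ 1 := by
    rw [hρ, div_le_one hz0]
    have := real_inner_le_norm z w
    rwa [hw, mul_one] at this
  have hτ : ρ^2 + (√(1-ρ^2))^2 = 1 := by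
    rw [Real.sq_sqrt (by nlinarith)]; ring
  have hl := pair_law z w rfl hw (by rw [hρ]; field_simp) hτ
  have m1 : Measurable (fun a : EuclideanSpace ℝ (Fin d) => (⟪a, z⟫, ⟪a, w⟫)) := by fun_prop
  have m2 : Measurable (fun p : ℝ × ℝ => (‖z‖ * p.1, ρ * p.1 + √(1-ρ^2) * p.2)) := by fun_prop
  have hcont : Continuous (fun q : ℝ × ℝ => psi q.1 (R * q.2)) :=
      psi_cont.comp (by fun_prop : Continuous fun q : ℝ × ℝ => (q.1, R * q.2))
  have e1 := integral_map (μ := _root_.stdGaussian d) m1.aemeasurable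
    (f := fun q : ℝ × ℝ => psi q.1 (R * q.2)) hcont.aestronglyMeasurable
  have e2 := integral_map (μ := (gaussianReal 0 1).prod (gaussianReal 0 1)) m2.aemeasurable
    (f := fun q : ℝ × ℝ => psi q.1 (R * q.2)) hcont.aestronglyMeasurable
  rw [hl] at e1
  rw [← e1, e2]
  exact expect_prod hz hz2 hR h0 (Real.sqrt_nonneg _) hτ

lemma expect {d : ℕ} (z w : EuclideanSpace ℝ (Fin d)) {R : ℝ} (hR : 1 ≤ R) (hz : 1 ≤ ‖z‖)
    (hz2 : ‖z‖ ≤ 2 * R) (hw : ‖w‖ = 1) :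
    0.004 / R ≤ ∫ a, psi ⟪a, z⟫ (R * ⟪a, w⟫) ∂_root_.stdGaussian d := by
  rcases le_total 0 ⟪z, w⟫ with h | h
  · exact expect_aux z w hR hz hz2 hw h
  · have := expect_aux z (-w) hR hz hz2 (by rwa [norm_neg]) (by rw [inner_neg_right]; linarith)
    simpa only [inner_neg_right, mul_neg, psi_abs_right] using this

end PSGM
namespace PSGM

/-- empirical first moment -/
def SS {d m : ℕ} (a : Fin m → EuclideanSpace ℝ (Fin d)) (w : EuclideanSpace ℝ (Fin d)) : ℝ :=
  (1 / m : ℝ) * ∑ i, |⟪a i, w⟫|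

lemma SS_add {d m : ℕ} (a : Fin m → EuclideanSpace ℝ (Fin d)) (v w : EuclideanSpace ℝ (Fin d)) :
    SS a (v + w) ≤ SS a v + SS a w := by
  unfold SS
  rw [← mul_add, ← Finset.sum_add_distrib]
  apply mul_le_mul_of_nonneg_left _ (by positivity)
  apply Finset.sum_le_sum
  intro i _
  rw [inner_add_right]
  exact abs_add_le _ _

lemma SS_smul {d m : ℕ} (a : Fin m → EuclideanSpace ℝ (Fin d)) (c : ℝ) (w : EuclideanSpace ℝ (Fin d)) :
    SS a (c • w) = |c| * SS a w := by
  unfold SS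
  rw [mul_left_comm, Finset.mul_sum Finset.univ _ |c|]
  congr 1
  apply Finset.sum_congr rfl
  intro i _
  rw [inner_smul_right, abs_mul]

lemma SS_bound {d m : ℕ} (a : Fin m → EuclideanSpace ℝ (Fin d)) {ε : ℝ} (hε : ε ≤ 1e-4)
    (N : Finset (EuclideanSpace ℝ (Fin d)))
    (hN : ∀ x : EuclideanSpace ℝ (Fin d), ‖x‖ = 1 → ∃ y ∈ N, ‖x - y‖ ≤ ε)
    (hS : ∀ w ∈ N, SS a w ≤ 1.2) (v : EuclideanSpace ℝ (Fin d)) : SS a v ≤ 5/4 * ‖v‖ := by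
  by_cases hv : v = 0
  · subst hv; simp [SS]
  have hcont : Continuous (SS a) := by unfold SS; fun_prop
  have hv0 : 0 < ‖v‖ := norm_pos_iff.2 hv
  have hunit : ∀ u : EuclideanSpace ℝ (Fin d), u ≠ 0 → ‖‖u‖⁻¹ • u‖ = 1 := fun u hu => by
    rw [norm_smul, norm_inv, norm_norm, inv_mul_cancel₀ (norm_ne_zero_iff.2 hu)]
  obtain ⟨w0, hw0, hmax⟩ := (isCompact_sphere (0 : EuclideanSpace ℝ (Fin d)) 1).exists_isMaxOn
    ⟨‖v‖⁻¹ • v, by simpa using hunit v hv⟩ hcont.continuousOn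
  have hw1 : ‖w0‖ = 1 := by simpa using hw0
  have hM : ∀ u : EuclideanSpace ℝ (Fin d), SS a u ≤ SS a w0 * ‖u‖ := by
    intro u
    by_cases hu : u = 0
    · subst hu; simp [SS]
    have h1 : SS a (‖u‖⁻¹ • u) ≤ SS a w0 := hmax (by simpa using hunit u hu)
    rw [SS_smul, abs_of_nonneg (by positivity), inv_mul_le_iff₀ (norm_pos_iff.2 hu)] at h1
    linarith
  have hM0 : 0 ≤ SS a w0 := by unfold SS; positivity
  obtain ⟨y, hy, hxy⟩ := hN w0 hw1
  have h1 := SS_add a y (w0 - y)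
  rw [add_sub_cancel] at h1
  have h2 := hM (w0 - y)
  have h3 := hS y hy
  have h4 : SS a w0 * ‖w0 - y‖ ≤ SS a w0 * 1e-4 := mul_le_mul_of_nonneg_left (hxy.trans hε) hM0
  have h5 : SS a w0 ≤ 5/4 := by norm_num at *; linarith
  exact (hM v).trans (mul_le_mul_of_nonneg_right h5 hv0.le)

lemma Psi_bound {d m : ℕ} (a : Fin m → EuclideanSpace ℝ (Fin d)) {R ε : ℝ} (hR : 1 ≤ R)
    (hε : ε = 1e-4 / R^2)
    (N1 N2 : Finset (EuclideanSpace ℝ (Fin d)))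
    (hN1 : ∀ x : EuclideanSpace ℝ (Fin d), 1 ≤ ‖x‖ → ‖x‖ ≤ 2 * R → ∃ y ∈ N1, ‖x - y‖ ≤ ε)
    (hN2 : ∀ x : EuclideanSpace ℝ (Fin d), ‖x‖ = 1 → ∃ y ∈ N2, ‖x - y‖ ≤ ε)
    (hS : ∀ v, SS a v ≤ 5/4 * ‖v‖)
    (hP : ∀ z ∈ N1, ∀ w ∈ N2, 0.0036 / R ≤ (1 / m : ℝ) * ∑ i, psi ⟪a i, z⟫ (R * ⟪a i, w⟫))
    (z w : EuclideanSpace ℝ (Fin d)) (hz : 1 ≤ ‖z‖) (hz2 : ‖z‖ ≤ 2 * R) (hw : ‖w‖ = 1) :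
    0.0032 / R ≤ (1 / m : ℝ) * ∑ i, psi ⟪a i, z⟫ (R * ⟪a i, w⟫) := by
  obtain ⟨z', hz', hzz⟩ := hN1 z hz hz2
  obtain ⟨w', hw', hww⟩ := hN2 w hw
  have h1 := hP z' hz' w' hw'
  have h2 : (1 / m : ℝ) * ∑ i, psi ⟪a i, z'⟫ (R * ⟪a i, w'⟫) ≤
      (1 / m : ℝ) * ∑ i, psi ⟪a i, z⟫ (R * ⟪a i, w⟫) + (2 * SS a (z - z') + R * SS a (w - w')) := by
    unfold SS
    have : ∑ i, psi ⟪a i, z'⟫ (R * ⟪a i, w'⟫) ≤ ∑ i, (psi ⟪a i, z⟫ (R * ⟪a i, w⟫) +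
        (2 * |⟪a i, z - z'⟫| + R * |⟪a i, w - w'⟫|)) := by
      apply Finset.sum_le_sum
      intro i _
      have := psi_lip ⟪a i, z'⟫ (R * ⟪a i, w'⟫) ⟪a i, z⟫ (R * ⟪a i, w⟫)
      rw [← mul_sub, abs_mul, abs_of_nonneg (by linarith : 0 ≤ R)] at this
      rw [inner_sub_right, inner_sub_right, abs_sub_comm ⟪a i, z⟫, abs_sub_comm ⟪a i, w⟫]
      have := (abs_le.1 this).2
      linarith
    rw [Finset.sum_add_distrib, Finset.sum_add_distrib, ← Finset.mul_sum, ← Finset.mul_sum] at this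
    have := mul_le_mul_of_nonneg_left this (by positivity : (0:ℝ) ≤ 1 / m)
    refine this.trans (le_of_eq ?_)
    ring
  have h3 : SS a (z - z') ≤ 5/4 * ε := (hS _).trans (by linarith)
  have h4 : SS a (w - w') ≤ 5/4 * ε := (hS _).trans (by linarith)
  have h5 : R * SS a (w - w') ≤ R * (5/4 * ε) := mul_le_mul_of_nonneg_left h4 (by linarith)
  have h6 : 2 * (5/4*ε) + R * (5/4*ε) ≤ 0.0004 / R := by
    have hR0 : 0 < R := by linarith
    rw [hε, le_div_iff₀ hR0]
    field_simp
    nlinarith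
  have : 0.0032 / R = 0.0036 / R - 0.0004 / R := by ring
  linarith

lemma psi_tail {d m : ℕ} (z w : EuclideanSpace ℝ (Fin d)) {R : ℝ} (hR : 1 ≤ R) (hz : 1 ≤ ‖z‖)
    (hz2 : ‖z‖ ≤ 2 * R) (hw : ‖w‖ = 1) :
    iidGaussian d m {a | ∑ i, psi ⟪a i, z⟫ (R * ⟪a i, w⟫) ≤ m * (0.0036 / R)} ≤
      ENNReal.ofReal (exp (-((0.0004/R)^2/2 * m))) := by
  have hcont : Continuous (fun a : EuclideanSpace ℝ (Fin d) => psi ⟪a, z⟫ (R * ⟪a, w⟫)) :=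
    psi_cont.comp (by fun_prop : Continuous fun a : EuclideanSpace ℝ (Fin d) => (⟪a, z⟫, R * ⟪a, w⟫))
  have := lower_tail (m := m) (t := 0.0004/R) (fun a : EuclideanSpace ℝ (Fin d) => psi ⟪a, z⟫ (R * ⟪a, w⟫))
    hcont.measurable (fun _ => psi_nonneg _ _) (fun _ => psi_le_one _ _)
    (by have : 0 < R := by linarith
        positivity) (expect z w hR hz hz2 hw)
  rw [show (0.004/R - 0.0004/R : ℝ) = 0.0036 / R by ring] at this
  exact this

lemma K_bound {R ε K : ℝ} (hR : 1 ≤ R) (hε : ε = 1e-4 / R^2) (hK : K ≤ 4 * R) :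
    1 + K / ε ≤ exp (1000 * R^2) := by
  have h := Real.quadratic_le_exp_of_nonneg (by positivity : 0 ≤ 1000 * R^2)
  refine le_trans ?_ h
  have : K / ε = K * R^2 * 1e4 := by rw [hε]; field_simp; ring
  rw [this]
  have h1 : K * R^2 ≤ 4 * R * R^2 := mul_le_mul_of_nonneg_right hK (by positivity)
  have h2 : R * R^2 ≤ R^2 * R^2 := mul_le_mul_of_nonneg_right (by nlinarith) (by positivity)
  nlinarith [sq_nonneg R]

lemma main_prob {d m : ℕ} {R : ℝ} (hR : 1 ≤ R) (hm : 1 ≤ m) (hC : 1e11 * d * R^4 ≤ m) :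
    ∃ B : Set (Fin m → EuclideanSpace ℝ (Fin d)),
      iidGaussian d m B ≤ ENNReal.ofReal (2 * exp (-(d:ℝ)/2)) ∧
      ∀ a, a ∉ B → (∀ w, (1 / m : ℝ) * ∑ i, |⟪a i, w⟫| ≤ 5/4 * ‖w‖) ∧
        (∀ z w : EuclideanSpace ℝ (Fin d), 1 ≤ ‖z‖ → ‖z‖ ≤ 2 * R → ‖w‖ = 1 →
          0.0032 / R ≤ (1 / m : ℝ) * ∑ i, psi ⟪a i, z⟫ (R * ⟪a i, w⟫)) := by
  have hR0 : 0 < R := by linarith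
  have hm0 : (0:ℝ) < m := by exact_mod_cast hm
  obtain ⟨ε, hε⟩ : ∃ ε : ℝ, ε = 1e-4 / R^2 := ⟨_, rfl⟩
  have hε0 : 0 < ε := by rw [hε]; positivity
  have hε1 : ε ≤ 1e-4 := by
    rw [hε]; apply div_le_self (by norm_num); nlinarith
  obtain ⟨N1, hN1, hc1, hn1⟩ := exists_net {z : EuclideanSpace ℝ (Fin d) | 1 ≤ ‖z‖ ∧ ‖z‖ ≤ 2 * R}
    (r := 2 * R) (by linarith) hε0 (fun c hc => hc.2)
  obtain ⟨N2, hN2, hc2, hn2⟩ := exists_net {z : EuclideanSpace ℝ (Fin d) | ‖z‖ = 1}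
    (r := 1) (by linarith) hε0 (fun c hc => le_of_eq hc)
  have hk1 : (N1.card : ℝ) ≤ exp (1000 * R^2 * d) := by
    refine hc1.trans ?_
    rw [mul_comm _ (d:ℝ), exp_nat_mul]
    exact pow_le_pow_left₀ (by positivity) (K_bound hR hε (by linarith)) d
  have hk2 : (N2.card : ℝ) ≤ exp (1000 * R^2 * d) := by
    refine hc2.trans ?_
    rw [mul_comm _ (d:ℝ), exp_nat_mul]
    exact pow_le_pow_left₀ (by positivity) (K_bound hR hε (by linarith)) d
  refine ⟨(⋃ w ∈ N2, {a | (m : ℝ) * 1.2 ≤ ∑ i, |⟪a i, w⟫|}) ∪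
    (⋃ q ∈ N1 ×ˢ N2, {a | ∑ i, psi ⟪a i, q.1⟫ (R * ⟪a i, q.2⟫) ≤ m * (0.0036 / R)}), ?_, ?_⟩
  · have hR2 : 1 ≤ R^2 := by nlinarith
    have hR4 : R^2 ≤ R^4 := by nlinarith
    have hd : (0:ℝ) ≤ d := Nat.cast_nonneg d
    have b1 : iidGaussian d m (⋃ w ∈ N2, {a | (m : ℝ) * 1.2 ≤ ∑ i, |⟪a i, w⟫|}) ≤
        ENNReal.ofReal (exp (-(d:ℝ)/2)) := by
      refine (measure_biUnion_finset_le _ _).trans ?_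
      refine (Finset.sum_le_card_nsmul _ _ _ (fun w hw => upper_tail w (hN2 w hw))).trans ?_
      rw [nsmul_eq_mul, ← ENNReal.ofReal_natCast, ← ENNReal.ofReal_mul (by positivity)]
      apply ENNReal.ofReal_le_ofReal
      refine (mul_le_mul_of_nonneg_right hk2 (exp_pos _).le).trans ?_
      rw [← exp_add]
      apply exp_le_exp.2
      have : (d:ℝ) * R^2 ≤ d * R^4 := mul_le_mul_of_nonneg_left hR4 hd
      have : (d:ℝ) * 1 ≤ d * R^2 := mul_le_mul_of_nonneg_left hR2 hd
      linarith
    have b2 : iidGaussian d m (⋃ q ∈ N1 ×ˢ N2, {a | ∑ i, psi ⟪a i, q.1⟫ (R * ⟪a i, q.2⟫) ≤ m * (0.0036 / R)}) ≤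
        ENNReal.ofReal (exp (-(d:ℝ)/2)) := by
      refine (measure_biUnion_finset_le _ _).trans ?_
      refine (Finset.sum_le_card_nsmul _ _ (ENNReal.ofReal (exp (-((0.0004/R)^2/2 * m)))) (fun q hq => ?_)).trans ?_
      · rw [Finset.mem_product] at hq
        have := hN1 _ hq.1
        exact psi_tail q.1 q.2 hR this.1 this.2 (hN2 _ hq.2)
      rw [nsmul_eq_mul, ← ENNReal.ofReal_natCast, ← ENNReal.ofReal_mul (by positivity), Finset.card_product]
      apply ENNReal.ofReal_le_ofReal
      push_cast
      refine (mul_le_mul_of_nonneg_right (mul_le_mul hk1 hk2 (by positivity) (exp_pos _).le) (exp_pos _).le).trans ?_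
      rw [← exp_add, ← exp_add]
      apply exp_le_exp.2
      have h1 : (0.0004/R)^2/2 * (1e11 * d * R^4) ≤ (0.0004/R)^2/2 * m :=
        mul_le_mul_of_nonneg_left hC (by positivity)
      have h2 : (0.0004/R)^2/2 * (1e11 * d * R^4) = 8000 * (d * R^2) := by field_simp; ring
      have : (d:ℝ) * 1 ≤ d * R^2 := mul_le_mul_of_nonneg_left hR2 hd
      linarith
    refine (measure_union_le _ _).trans ((add_le_add b1 b2).trans (le_of_eq ?_))
    rw [← ENNReal.ofReal_add (exp_pos _).le (exp_pos _).le, two_mul]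
  · intro a ha
    simp only [Set.mem_union, Set.mem_iUnion, not_or, not_exists, Set.mem_ofPred_eq, not_le] at ha
    obtain ⟨g1, g2⟩ := ha
    have hS : ∀ v, SS a v ≤ 5/4 * ‖v‖ := SS_bound a hε1 N2 (fun x hx => hn2 x hx) (fun w hw => by
      have := g1 w hw
      unfold SS
      rw [one_div, inv_mul_le_iff₀ hm0]; exact this.le)
    refine ⟨hS, Psi_bound a hR hε N1 N2 (fun x h h' => hn1 x ⟨h, h'⟩) (fun x hx => hn2 x hx) hS ?_⟩
    intro z hz w hw
    have := g2 (z, w) (Finset.mk_mem_product hz hw)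
    rw [one_div, le_inv_mul_iff₀ hm0]; exact this.le

end PSGM

/-- Linear convergence of the Polyak subgradient method: slow-phase contraction at rate
`1 - (η/5) κ^{-5/2}` for the first `T₀` iterations and fast-phase contraction at rate
`1 - η κ^{-2}` afterwards, with probability at least `1 - c exp(-d/2)`. -/
theorem polyakSGM_linear_convergence :
    ∃ C c : ℝ, 0 < C ∧ 0 < c ∧
      ∀ (d m : ℕ) (xstar : EuclideanSpace ℝ (Fin d)), 1 ≤ d → 1 ≤ m →
        1 ≤ ‖xstar‖ → C * d * ‖xstar‖ ^ 4 ≤ m →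
        ∀ μ L κ : ℝ,
          μ = 1 / (4 * Real.sqrt π * (1 + 9 * π * ‖xstar‖ ^ 2)) →
          L = 1 + 2 * Real.sqrt (d / m) →
          κ = 8 * Real.sqrt π * (1 + 9 * π * ‖xstar‖ ^ 2) →
          ∀ η : ℝ, 0 < η → η ≤ 1 / κ →
            ∀ ρbar : ℝ, ρbar = η * (μ / L) ^ 2 / (40 * Real.sqrt π * ‖xstar‖) →
              ∀ T₀ : ℕ, T₀ = ⌈Real.log 2 / ρbar⌉₊ →
                ENNReal.ofReal (1 - c * Real.exp (-(d : ℝ) / 2)) ≤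
                  iidGaussian d m {a |
                    ∀ x : ℕ → EuclideanSpace ℝ (Fin d), x 0 = 0 →
                      (∀ k : ℕ, x (k + 1) =
                        if subgrad xstar a (x k) = 0 then x k
                        else x k - (η * loss xstar a (x k) / ‖subgrad xstar a (x k)‖ ^ 2) •
                          subgrad xstar a (x k)) →
                      (∀ i : ℕ, i < T₀ →
                          ‖x (i + 1) - xstar‖ ^ 2 ≤
                            (1 - η / 5 * κ ^ ((-5 : ℝ) / 2)) * ‖x i - xstar‖ ^ 2) ∧
                      (∀ i : ℕ, T₀ ≤ i →
                          ‖x (i + 1) - xstar‖ ^ 2 ≤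
                            (1 - η / κ ^ 2) * ‖x i - xstar‖ ^ 2)} := by
  refine ⟨1e11, 2, by norm_num, by norm_num, ?_⟩
  intro d m xstar hd hm hR hC μ L κ hμ hL hκ η hη hη1 ρbar hρ T₀ hT
  obtain ⟨B, hB, hgood⟩ := PSGM.main_prob (d := d) hR hm hC
  have hκ1 := (PSGM.kappa_ge hκ).2
  have hsub : Bᶜ ⊆ {a |
                    ∀ x : ℕ → EuclideanSpace ℝ (Fin d), x 0 = 0 →
                      (∀ k : ℕ, x (k + 1) =
                        if subgrad xstar a (x k) = 0 then x k
                        else x k - (η * loss xstar a (x k) / ‖subgrad xstar a (x k)‖ ^ 2) •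
                          subgrad xstar a (x k)) →
                      (∀ i : ℕ, i < T₀ →
                          ‖x (i + 1) - xstar‖ ^ 2 ≤
                            (1 - η / 5 * κ ^ ((-5 : ℝ) / 2)) * ‖x i - xstar‖ ^ 2) ∧
                      (∀ i : ℕ, T₀ ≤ i →
                          ‖x (i + 1) - xstar‖ ^ 2 ≤
                            (1 - η / κ ^ 2) * ‖x i - xstar‖ ^ 2)} := by
    intro a ha x hx0 hx
    obtain ⟨hS, hP⟩ := hgood a ha
    have hdet := PSGM.determ xstar a rfl hR hκ hη hη1 hS hP x hx0 hx
    refine ⟨fun i _ => ?_, fun i _ => hdet i⟩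
    exact (hdet i).trans (mul_le_mul_of_nonneg_right (PSGM.rate hκ1 hη) (sq_nonneg _))
  refine le_trans ?_ (measure_mono hsub)
  have h1 : (1 : ℝ≥0∞) ≤ iidGaussian d m B + iidGaussian d m Bᶜ := by
    have := measure_union_le (μ := iidGaussian d m) B Bᶜ
    rwa [Set.union_compl_self, measure_univ] at this
  rw [ENNReal.ofReal_sub _ (by positivity), ENNReal.ofReal_one]
  refine tsub_le_iff_left.2 (h1.trans ?_)
  gcongr
end
end

section
/- One-step contraction of the Polyak step: let x, x⋆, v ∈ ℝ^d with v ≠ 0, let F ≥ 0 be a real number (the function value at x, with optimal value 0), and let μ, L, η > 0 satisfy ⟨v, x − x⋆⟩ ≥ μ·‖x − x⋆‖, ‖v‖ ≤ L, F ≤ L·‖x − x⋆‖, and η ≤ μ/L. Then the Polyak update x⁺ := x − η·(F/‖v‖²)·v satisfies ‖x⁺ − x⋆‖² ≤ ‖x − x⋆‖² − (η·μ·F/L²)·‖x − x⋆‖. -/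
open Real
open scoped RealInnerProductSpace

noncomputable section

/-- One-step contraction of the Polyak step: if `⟨v, x - x⋆⟩ ≥ μ‖x - x⋆‖`, `‖v‖ ≤ L`,
`0 ≤ F ≤ L‖x - x⋆‖` and `0 < η ≤ μ/L`, then the update `x⁺ = x - η (F/‖v‖²) v` satisfies
`‖x⁺ - x⋆‖² ≤ ‖x - x⋆‖² - (ημF/L²)‖x - x⋆‖`. -/
theorem polyak_one_step_contraction (d : ℕ) (x xstar v : EuclideanSpace ℝ (Fin d))
    (hv : v ≠ 0) (F μ L η : ℝ) (hF : 0 ≤ F) (hμ : 0 < μ) (hL : 0 < L) (hη : 0 < η)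
    (haim : μ * ‖x - xstar‖ ≤ ⟪v, x - xstar⟫)
    (hvL : ‖v‖ ≤ L)
    (hFL : F ≤ L * ‖x - xstar‖)
    (hηL : η ≤ μ / L) :
    ‖(x - (η * F / ‖v‖ ^ 2) • v) - xstar‖ ^ 2 ≤
      ‖x - xstar‖ ^ 2 - (η * μ * F / L ^ 2) * ‖x - xstar‖ := by
  have hn : 0 < ‖v‖ := norm_pos_iff.mpr hv
  have e : (x - (η * F / ‖v‖ ^ 2) • v) - xstar = (x - xstar) - (η * F / ‖v‖ ^ 2) • v := by abel
  rw [e, norm_sub_sq_real, inner_smul_right, norm_smul, mul_pow, Real.norm_eq_abs, sq_abs,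
    real_inner_comm]
  have hD : 0 ≤ ‖x - xstar‖ := norm_nonneg _
  have h1 : η * F ≤ μ * ‖x - xstar‖ := by
    calc η * F ≤ (μ / L) * (L * ‖x - xstar‖) := by gcongr
      _ = μ * ‖x - xstar‖ := by field_simp
  have ht : η * F / L ^ 2 ≤ η * F / ‖v‖ ^ 2 := by gcongr
  have h0 : 0 ≤ η * F / ‖v‖ ^ 2 := by positivity
  have hs : (η * F / ‖v‖ ^ 2) ^ 2 * ‖v‖ ^ 2 = (η * F / ‖v‖ ^ 2) * (η * F) := by field_simp
  have hr : η * μ * F / L ^ 2 * ‖x - xstar‖ = (η * F / L ^ 2) * (μ * ‖x - xstar‖) := by ring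
  rw [hs, hr]
  have a1 := mul_le_mul_of_nonneg_left h1 h0
  have a2 := mul_le_mul_of_nonneg_left haim h0
  have a3 := mul_le_mul_of_nonneg_right ht (mul_nonneg hμ.le hD)
  linarith
end
end

section
/- Iterate norm bounds in the slow phase: let x⋆ ∈ ℝ^d with ‖x⋆‖ ≥ 1, let ρ̄ ∈ (0, 1), and let (x_k)_{k≥0} be a sequence in ℝ^d with x₀ = 0. Suppose that ‖x₁ − x⋆‖² ≤ (1 − 1/(20·√π·‖x⋆‖))·‖x⋆‖² and that ‖x_{j+1} − x⋆‖² ≤ (1 − ρ̄)·‖x_j − x⋆‖² for every 1 ≤ j ≤ t. Then 1/(40·√π) ≤ ‖x_{t+1}‖ < 2·‖x⋆‖. -/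
open Real

noncomputable section

/-- Iterate norm bounds in the slow phase: if `x₀ = 0`,
`‖x₁ - x⋆‖² ≤ (1 - 1/(20√π‖x⋆‖))‖x⋆‖²` and `‖x_{j+1} - x⋆‖² ≤ (1 - ρ̄)‖x_j - x⋆‖²` for all
`1 ≤ j ≤ t`, then `1/(40√π) ≤ ‖x_{t+1}‖ < 2‖x⋆‖`. -/
theorem slow_phase_norm_bounds (d : ℕ) (xstar : EuclideanSpace ℝ (Fin d))
    (hxstar : 1 ≤ ‖xstar‖) (ρbar : ℝ) (hρ : ρbar ∈ Set.Ioo (0 : ℝ) 1)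
    (x : ℕ → EuclideanSpace ℝ (Fin d)) (hx0 : x 0 = 0) (t : ℕ)
    (hx1 : ‖x 1 - xstar‖ ^ 2 ≤ (1 - 1 / (20 * Real.sqrt π * ‖xstar‖)) * ‖xstar‖ ^ 2)
    (hcontract : ∀ j : ℕ, 1 ≤ j → j ≤ t →
      ‖x (j + 1) - xstar‖ ^ 2 ≤ (1 - ρbar) * ‖x j - xstar‖ ^ 2) :
    1 / (40 * Real.sqrt π) ≤ ‖x (t + 1)‖ ∧ ‖x (t + 1)‖ < 2 * ‖xstar‖ := by
  have key : ∀ k : ℕ, k ≤ t → ‖x (k + 1) - xstar‖ ^ 2 ≤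
      (1 - 1 / (20 * Real.sqrt π * ‖xstar‖)) * ‖xstar‖ ^ 2 := by
    intro k
    induction k with
    | zero => intro _; simpa using hx1
    | succ k ih =>
      intro hk
      have h1 := ih (by omega)
      have h2 := hcontract (k + 1) (by omega) hk
      have h3 := mul_nonneg hρ.1.le (sq_nonneg ‖x (k + 1) - xstar‖)
      linarith
  have hD := key t le_rfl
  have hs : 1 ≤ Real.sqrt π := by
    rw [Real.one_le_sqrt]; linarith [Real.pi_gt_three]
  have hr : 0 < ‖xstar‖ := by linarith
  have hc0 : 0 < 1 / (40 * Real.sqrt π) := by positivity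
  have hc1 : 1 / (40 * Real.sqrt π) ≤ 1 := by
    rw [div_le_one (by positivity)]; linarith
  have heq : (1 - 1 / (20 * Real.sqrt π * ‖xstar‖)) * ‖xstar‖ ^ 2
      = ‖xstar‖ ^ 2 - 2 * (1 / (40 * Real.sqrt π)) * ‖xstar‖ := by
    field_simp
    ring
  rw [heq] at hD
  generalize 1 / (40 * Real.sqrt π) = c at *
  have hle : ‖x (t + 1) - xstar‖ ≤ ‖xstar‖ - c := by
    refine abs_le_of_sq_le_sq' ?_ (by linarith) |>.2
    nlinarith [sq_nonneg c]
  have h1 : ‖xstar‖ - ‖x (t + 1)‖ ≤ ‖x (t + 1) - xstar‖ := by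
    rw [norm_sub_rev]; exact norm_sub_norm_le _ _
  have h2 : ‖x (t + 1)‖ - ‖xstar‖ ≤ ‖x (t + 1) - xstar‖ := norm_sub_norm_le _ _
  constructor <;> linarith
end
end

section
/- The function x ↦ exp(x²)·erfc(x) is (strictly) monotone decreasing on [0, ∞); that is, for all 0 ≤ x < y, exp(y²)·erfc(y) < exp(x²)·erfc(x). -/
open Real

noncomputable section

open MeasureTheory in
lemma erfc_aux_int (x : ℝ) :
    Integrable (fun t : ℝ => Real.exp (x ^ 2) * Real.exp (-(t + x) ^ 2)) := by
  have h := (integrable_exp_neg_mul_sq (b := 1) one_pos).comp_add_right x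
  simp only [neg_mul, one_mul] at h
  exact h.const_mul _

open MeasureTheory in
lemma erfc_aux_eq (x : ℝ) : Real.exp (x ^ 2) * ∫ u in Set.Ioi x, Real.exp (-u ^ 2)
    = ∫ t in Set.Ioi (0 : ℝ), Real.exp (x ^ 2) * Real.exp (-(t + x) ^ 2) := by
  rw [integral_const_mul]
  congr 1
  have h := (measurePreserving_add_right (volume : Measure ℝ) x).setIntegral_preimage_emb
    (measurableEmbedding_addRight x) (fun u => Real.exp (-u ^ 2)) (Set.Ioi x)
  rw [← h]
  simp

open MeasureTheory in
lemma erfc_aux_lt (x y : ℝ) (hxy : x < y) :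
    Real.exp (y ^ 2) * ∫ u in Set.Ioi y, Real.exp (-u ^ 2) <
    Real.exp (x ^ 2) * ∫ u in Set.Ioi x, Real.exp (-u ^ 2) := by
  rw [erfc_aux_eq, erfc_aux_eq, ← sub_pos,
    ← integral_sub (erfc_aux_int x).integrableOn (erfc_aux_int y).integrableOn]
  have key : ∀ t ∈ Set.Ioi (0 : ℝ), 0 < Real.exp (x ^ 2) * Real.exp (-(t + x) ^ 2)
      - Real.exp (y ^ 2) * Real.exp (-(t + y) ^ 2) := by
    intro t ht
    have ht : 0 < t := ht
    rw [sub_pos, ← Real.exp_add, ← Real.exp_add, Real.exp_lt_exp]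
    nlinarith [mul_pos ht (sub_pos.2 hxy)]
  rw [setIntegral_pos_iff_support_of_nonneg_ae]
  · rw [Set.inter_eq_right.2 (fun t ht => Function.mem_support.2 (key t ht).ne')]
    simp
  · exact (ae_restrict_mem measurableSet_Ioi).mono fun t ht => (key t ht).le
  · exact ((erfc_aux_int x).sub (erfc_aux_int y)).integrableOn

/-- `x ↦ exp(x²) erfc(x)` is strictly decreasing on `[0, ∞)`. -/
theorem exp_sq_mul_erfc_strictAnti :
    ∀ x y : ℝ, 0 ≤ x → x < y →
      Real.exp (y ^ 2) * erfc y < Real.exp (x ^ 2) * erfc x := by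
  intro x y _ hxy
  have h := erfc_aux_lt x y hxy
  have hp : 0 < 2 / Real.sqrt π := by positivity
  have h2 := mul_lt_mul_of_pos_left h hp
  unfold erfc
  linarith
end
end

section
/- The function x ↦ x·exp(x²)·erfc(x) is (strictly) monotone increasing on [0, ∞); that is, for all 0 ≤ x < y, x·exp(x²)·erfc(x) < y·exp(y²)·erfc(y). -/
open Real

noncomputable section

open MeasureTheory in
lemma aux_eq (x : ℝ) (hx : 0 < x) :
    x * Real.exp (x ^ 2) * ∫ u in Set.Ioi x, Real.exp (-u ^ 2)
      = ∫ s in Set.Ioi (0:ℝ), Real.exp (-2 * s - s ^ 2 / x ^ 2) := by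
  have h1 : ∫ u in Set.Ioi x, Real.exp (-u ^ 2)
      = ∫ v in Set.Ioi (0:ℝ), Real.exp (-(v + x) ^ 2) := by
    have := (measurePreserving_add_right volume x).setIntegral_preimage_emb
      (measurableEmbedding_addRight x) (fun u => Real.exp (-u ^ 2)) (Set.Ioi x)
    rw [← this]
    simp
  have h2 := integral_comp_mul_left_Ioi (fun v => Real.exp (-(v + x) ^ 2)) 0 (inv_pos.2 hx)
  simp only [mul_zero, inv_inv, smul_eq_mul] at h2
  rw [h1, mul_right_comm, ← h2, mul_comm, ← integral_const_mul]
  refine integral_congr_ae (Filter.Eventually.of_forall fun s => ?_)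
  simp only
  rw [← Real.exp_add]
  congr 1
  field_simp
  ring

open MeasureTheory in
lemma aux_int (x : ℝ) :
    IntegrableOn (fun s => Real.exp (-2 * s - s ^ 2 / x ^ 2)) (Set.Ioi (0:ℝ)) := by
  refine Integrable.mono' (exp_neg_integrableOn_Ioi 0 (b := 2) (by norm_num))
    (by measurability) (Filter.Eventually.of_forall fun s => ?_)
  rw [Real.norm_eq_abs, abs_of_pos (Real.exp_pos _)]
  apply Real.exp_le_exp.2
  have : 0 ≤ s ^ 2 / x ^ 2 := by positivity
  linarith

open MeasureTheory in
lemma aux_pos (f : ℝ → ℝ) (hf : IntegrableOn f (Set.Ioi (0:ℝ)))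
    (h : ∀ s, 0 < s → 0 < f s) : 0 < ∫ s in Set.Ioi (0:ℝ), f s := by
  rw [setIntegral_pos_iff_support_of_nonneg_ae _ hf]
  · have : Function.support f ∩ Set.Ioi (0:ℝ) = Set.Ioi 0 :=
      Set.inter_eq_right.2 fun s hs => (h s hs).ne'
    rw [this]; simp
  · exact (ae_restrict_iff' measurableSet_Ioi).2
      (Filter.Eventually.of_forall fun s hs => (h s hs).le)

/-- `x ↦ x exp(x²) erfc(x)` is strictly increasing on `[0, ∞)`. -/
theorem mul_exp_sq_mul_erfc_strictMono :
    ∀ x y : ℝ, 0 ≤ x → x < y →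
      x * Real.exp (x ^ 2) * erfc x < y * Real.exp (y ^ 2) * erfc y := by
  intro x y hx hxy
  have hy : 0 < y := hx.trans_lt hxy
  have hc : 0 < 2 / Real.sqrt π := by positivity
  unfold erfc
  rw [mul_left_comm, mul_left_comm _ (2 / Real.sqrt π)]
  refine mul_lt_mul_of_pos_left ?_ hc
  rw [aux_eq y hy]
  rcases hx.eq_or_lt with rfl | hx
  · simp only [zero_mul]
    exact aux_pos _ (aux_int y) fun s _ => Real.exp_pos _
  · rw [aux_eq x hx, ← sub_pos, ← MeasureTheory.integral_sub (aux_int y) (aux_int x)]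
    refine aux_pos _ ((aux_int y).sub (aux_int x)) fun s hs => sub_pos.2 (Real.exp_lt_exp.2 ?_)
    have : s ^ 2 / y ^ 2 < s ^ 2 / x ^ 2 := by gcongr
    linarith
end
end

section
/- For every real x ≥ 1, the bound x·exp(x²/2)·erfc(x/√2) ≤ √(2/π)·(1 − 1/(1 + π·x²)) holds. -/
open Real

noncomputable section

theorem aux_tail (a : ℝ) (ha : 0 < a) (h2 : 1 ≤ 2 * a ^ 2) :
    ∫ u in Set.Ioi a, Real.exp (-u ^ 2) ≤ π * a / (1 + 2 * π * a ^ 2) * Real.exp (-a ^ 2) := by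
  have hpi := Real.pi_gt_three
  have hden : ∀ u : ℝ, 0 < 1 + 2 * π * u ^ 2 := fun u => by positivity
  let F' : ℝ → ℝ := fun u =>
    ((π * (1 + 2 * π * u ^ 2) - π * u * (4 * π * u)) / (1 + 2 * π * u ^ 2) ^ 2
      - 2 * u * (π * u / (1 + 2 * π * u ^ 2))) * Real.exp (-u ^ 2)
  have hF : ∀ u : ℝ, HasDerivAt
      (fun u : ℝ => π * u / (1 + 2 * π * u ^ 2) * Real.exp (-u ^ 2)) (F' u) u := by
    intro u
    have h1 : HasDerivAt (fun u : ℝ => π * u) π u := by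
      simpa using (hasDerivAt_id u).const_mul π
    have h3 : HasDerivAt (fun u : ℝ => u ^ 2) (2 * u) u := by
      simpa using hasDerivAt_pow 2 u
    have h4 : HasDerivAt (fun u : ℝ => 1 + 2 * π * u ^ 2) (2 * π * (2 * u)) u :=
      (h3.const_mul (2 * π)).const_add 1
    have h5 : HasDerivAt (fun u : ℝ => Real.exp (-u ^ 2)) (Real.exp (-u ^ 2) * (-(2 * u))) u :=
      h3.neg.exp
    refine ((h1.div h4 (hden u).ne').mul h5).congr_deriv ?_
    simp only [F', Pi.div_apply]
    ring
  have hle : ∀ u ∈ Set.Ioi a, Real.exp (-u ^ 2) ≤ - F' u := by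
    intro u hu
    have hu' : a < u := hu
    have hu2 : 1 ≤ 2 * u ^ 2 := by nlinarith
    have hd := hden u
    have : 1 ≤ -((π * (1 + 2 * π * u ^ 2) - π * u * (4 * π * u)) / (1 + 2 * π * u ^ 2) ^ 2
      - 2 * u * (π * u / (1 + 2 * π * u ^ 2))) := by
      have e : -((π * (1 + 2 * π * u ^ 2) - π * u * (4 * π * u)) / (1 + 2 * π * u ^ 2) ^ 2
        - 2 * u * (π * u / (1 + 2 * π * u ^ 2))) - 1
          = ((π ^ 2 - π) * (2 * u ^ 2) - (1 + π)) / (1 + 2 * π * u ^ 2) ^ 2 := by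
        field_simp
        ring
      have : 0 ≤ ((π ^ 2 - π) * (2 * u ^ 2) - (1 + π)) / (1 + 2 * π * u ^ 2) ^ 2 := by
        apply div_nonneg _ (by positivity)
        have : 0 ≤ π ^ 2 - π := by nlinarith
        nlinarith
      linarith
    have h := mul_le_mul_of_nonneg_right this (Real.exp_pos (-u ^ 2)).le
    simp only [F']
    linarith
  have hlim : Filter.Tendsto (fun u : ℝ => π * u / (1 + 2 * π * u ^ 2) * Real.exp (-u ^ 2))
      Filter.atTop (nhds 0) := by
    refine squeeze_zero' (g := fun u : ℝ => Real.exp (-u)) ?_ ?_ 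
      Real.tendsto_exp_neg_atTop_nhds_zero
    · filter_upwards [Filter.eventually_ge_atTop 1] with u hu
      have := hden u
      positivity
    · filter_upwards [Filter.eventually_ge_atTop 1] with u hu
      have h1 : π * u / (1 + 2 * π * u ^ 2) ≤ 1 := by
        rw [div_le_one (hden u)]
        have : 0 ≤ u * (u - 1) := mul_nonneg (by linarith) (by linarith)
        nlinarith [mul_nonneg (by linarith : (0:ℝ) ≤ π) this, mul_nonneg (by linarith : (0:ℝ) ≤ π) (sq_nonneg u)]
      have h2 : Real.exp (-u ^ 2) ≤ Real.exp (-u) := Real.exp_le_exp.2 (by nlinarith)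
      have := Real.exp_pos (-u ^ 2)
      nlinarith
  have hneg : ∀ u ∈ Set.Ioi a, F' u ≤ 0 := fun u hu => by
    have := hle u hu
    have := Real.exp_pos (-u ^ 2)
    linarith
  have hint : MeasureTheory.IntegrableOn F' (Set.Ioi a) :=
    MeasureTheory.integrableOn_Ioi_deriv_of_nonpos' (fun u _ => hF u) hneg hlim
  have hval := MeasureTheory.integral_Ioi_of_hasDerivAt_of_tendsto' (fun u _ => hF u) hint hlim
  have hexp : MeasureTheory.IntegrableOn (fun u : ℝ => Real.exp (-u ^ 2)) (Set.Ioi a) := by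
    have := integrable_exp_neg_mul_sq (b := 1) one_pos
    simpa using this.integrableOn (s := Set.Ioi a)
  have hm := MeasureTheory.setIntegral_mono_on hexp hint.neg measurableSet_Ioi hle
  have : ∫ u in Set.Ioi a, (-F') u = - ∫ u in Set.Ioi a, F' u := MeasureTheory.integral_neg _
  rw [this, hval] at hm
  linarith

/-- For `x ≥ 1`, `x exp(x²/2) erfc(x/√2) ≤ √(2/π)(1 - 1/(1 + πx²))`. -/
theorem mul_exp_erfc_upper_bound (x : ℝ) (hx : 1 ≤ x) :
    x * Real.exp (x ^ 2 / 2) * erfc (x / Real.sqrt 2) ≤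
      Real.sqrt (2 / π) * (1 - 1 / (1 + π * x ^ 2)) := by
  have hpi := Real.pi_pos
  have h2 : Real.sqrt 2 ^ 2 = 2 := Real.sq_sqrt (by norm_num)
  have h2p : 0 < Real.sqrt 2 := by positivity
  have hpp : 0 < Real.sqrt π := by positivity
  have hsq : (x / Real.sqrt 2) ^ 2 = x ^ 2 / 2 := by rw [div_pow, h2]
  have hx0 : 0 < x := by linarith
  have h := aux_tail (x / Real.sqrt 2) (by positivity) (by rw [hsq]; nlinarith)
  rw [hsq] at h
  unfold erfc
  have hE : Real.exp (x ^ 2 / 2) * Real.exp (-(x ^ 2 / 2)) = 1 := by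
    rw [← Real.exp_add]; simp
  have hd : 0 < 1 + π * x ^ 2 := by positivity
  calc _ ≤ x * Real.exp (x ^ 2 / 2) * (2 / Real.sqrt π *
        (π * (x / Real.sqrt 2) / (1 + 2 * π * (x ^ 2 / 2)) * Real.exp (-(x ^ 2 / 2)))) := by
        gcongr
    _ = (Real.exp (x ^ 2 / 2) * Real.exp (-(x ^ 2 / 2))) * (2 / Real.sqrt π *
        (π * x ^ 2 / Real.sqrt 2 / (1 + π * x ^ 2))) := by
        rw [show 2 * π * (x ^ 2 / 2) = π * x ^ 2 by ring]
        ring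
    _ = _ := by
        rw [hE, Real.sqrt_div (by norm_num)]
        field_simp
        rw [h2]
        ring
end
end

section
/- Proximal operator of the row-wise group norm: let M ∈ ℝ^{m×n} and μ > 0, and define ‖X‖_{1,2} := Σ_{i=1}^m ‖X_{i,:}‖ (the sum of the Euclidean norms of the rows of X). Let S_μ(M) be the matrix whose i-th row is M_{i,:}·(1 − μ/max(‖M_{i,:}‖, μ)). Then S_μ(M) is the unique global minimizer over ℝ^{m×n} of the function X ↦ (1/(2μ))·‖X − M‖_F² + ‖X‖_{1,2}, where ‖·‖_F is the Frobenius norm. Moreover, ‖S_μ(M)‖_{1,2} = Σ_{i=1}^m max(‖M_{i,:}‖ − μ, 0). -/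
open Real
open scoped BigOperators

noncomputable section

/-- Euclidean norm of the `i`-th row of a matrix. -/
def rowNorm {m n : ℕ} (X : Matrix (Fin m) (Fin n) ℝ) (i : Fin m) : ℝ :=
  Real.sqrt (∑ j, X i j ^ 2)

/-- The group norm `‖X‖_{1,2} = ∑ᵢ ‖X_{i,:}‖`. -/
def groupNorm {m n : ℕ} (X : Matrix (Fin m) (Fin n) ℝ) : ℝ :=
  ∑ i, rowNorm X i

/-- The Frobenius norm `‖X‖_F = (∑_{i,j} X_{ij}²)^{1/2}`. -/
def frobNorm {m n : ℕ} (X : Matrix (Fin m) (Fin n) ℝ) : ℝ :=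
  Real.sqrt (∑ i, ∑ j, X i j ^ 2)

/-- Row-wise shrinkage: `S_μ(M)_{i,:} = M_{i,:}·(1 - μ/max(‖M_{i,:}‖, μ))`. -/
def rowShrink {m n : ℕ} (μ : ℝ) (M : Matrix (Fin m) (Fin n) ℝ) : Matrix (Fin m) (Fin n) ℝ :=
  fun i j => M i j * (1 - μ / max (rowNorm M i) μ)

lemma rowNorm_nonneg' {m n : ℕ} (X : Matrix (Fin m) (Fin n) ℝ) (i : Fin m) : 0 ≤ rowNorm X i :=
  Real.sqrt_nonneg _

lemma rowNorm_sq' {m n : ℕ} (X : Matrix (Fin m) (Fin n) ℝ) (i : Fin m) :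
    rowNorm X i ^ 2 = ∑ j, X i j ^ 2 :=
  Real.sq_sqrt (Finset.sum_nonneg fun _ _ => sq_nonneg _)

lemma frobNorm_sq' {m n : ℕ} (X : Matrix (Fin m) (Fin n) ℝ) :
    frobNorm X ^ 2 = ∑ i, ∑ j, X i j ^ 2 :=
  Real.sq_sqrt (Finset.sum_nonneg fun _ _ => Finset.sum_nonneg fun _ _ => sq_nonneg _)

lemma shrink_coef_nonneg {r μ : ℝ} (hμ : 0 < μ) : 0 ≤ 1 - μ / max r μ := by
  have hK : 0 < max r μ := lt_max_of_lt_right hμ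
  rw [sub_nonneg, div_le_one hK]
  exact le_max_right _ _

lemma rowNorm_shrink {m n : ℕ} (M : Matrix (Fin m) (Fin n) ℝ) (μ : ℝ) (hμ : 0 < μ) (i : Fin m) :
    rowNorm (rowShrink μ M) i = (1 - μ / max (rowNorm M i) μ) * rowNorm M i := by
  have h1 : rowNorm (rowShrink μ M) i ^ 2 = ((1 - μ / max (rowNorm M i) μ) * rowNorm M i) ^ 2 := by
    rw [rowNorm_sq', mul_pow, rowNorm_sq' M, Finset.mul_sum]
    refine Finset.sum_congr rfl fun j _ => ?_
    simp only [rowShrink]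
    ring
  exact (pow_left_inj₀ (rowNorm_nonneg' _ _)
    (mul_nonneg (shrink_coef_nonneg hμ) (rowNorm_nonneg' _ _)) two_ne_zero).1 h1

lemma row_ineq {m n : ℕ} (M X : Matrix (Fin m) (Fin n) ℝ) (μ : ℝ) (hμ : 0 < μ) (i : Fin m) :
    ∑ j, (rowShrink μ M i j - M i j) ^ 2 + 2 * μ * rowNorm (rowShrink μ M) i
      + ∑ j, (X i j - rowShrink μ M i j) ^ 2 ≤
    ∑ j, (X i j - M i j) ^ 2 + 2 * μ * rowNorm X i := by
  rw [rowNorm_shrink M μ hμ]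
  have hr := rowNorm_nonneg' M i
  have ha := rowNorm_nonneg' X i
  have hr2 := rowNorm_sq' M i
  have ha2 := rowNorm_sq' X i
  have hP : ∑ j, X i j * M i j ≤ rowNorm X i * rowNorm M i :=
    Real.sum_mul_le_sqrt_mul_sqrt _ _ _
  have hK : 0 < max (rowNorm M i) μ := lt_max_of_lt_right hμ
  simp only [rowShrink]
  have hrK : rowNorm M i ≤ max (rowNorm M i) μ := le_max_left _ _
  have hz : (1 - μ / max (rowNorm M i) μ) * (rowNorm M i - max (rowNorm M i) μ) = 0 := by
    rcases le_total (rowNorm M i) μ with h | h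
    · rw [max_eq_right h, div_self hμ.ne']; ring
    · rw [max_eq_left h]; ring
  have htK : μ / max (rowNorm M i) μ * max (rowNorm M i) μ = μ := div_mul_cancel₀ _ hK.ne'
  have ht : 0 ≤ μ / max (rowNorm M i) μ := by positivity
  generalize max (rowNorm M i) μ = K at *
  generalize μ / K = t at *
  generalize rowNorm M i = r at *
  generalize rowNorm X i = a at *
  have e1 : ∑ j, (M i j * (1 - t) - M i j) ^ 2 = t ^ 2 * r ^ 2 := by
    rw [hr2, Finset.mul_sum]
    exact Finset.sum_congr rfl fun j _ => by ring
  have e (c : ℝ) : ∑ j, (X i j - M i j * c) ^ 2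
      = a ^ 2 - 2 * c * ∑ j, X i j * M i j + c ^ 2 * r ^ 2 := by
    rw [hr2, ha2, Finset.mul_sum, Finset.mul_sum, ← Finset.sum_sub_distrib,
      ← Finset.sum_add_distrib]
    exact Finset.sum_congr rfl fun j _ => by ring
  have e3 := e 1
  simp only [mul_one] at e3
  rw [e1, e (1 - t), e3]
  generalize ∑ j, X i j * M i j = P at *
  have h1 : 0 ≤ t * (K * a - P) := mul_nonneg ht (by nlinarith)
  have h2 : t * r * ((1 - t) * (r - K)) = 0 := by rw [hz]; ring
  rw [← htK]
  nlinarith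

/-- `S_μ(M)` is the unique global minimizer of `X ↦ (1/(2μ))‖X - M‖_F² + ‖X‖_{1,2}`,
and `‖S_μ(M)‖_{1,2} = ∑ᵢ max(‖M_{i,:}‖ - μ, 0)`. -/
theorem prox_group_norm (m n : ℕ) (M : Matrix (Fin m) (Fin n) ℝ) (μ : ℝ) (hμ : 0 < μ) :
    (∀ X : Matrix (Fin m) (Fin n) ℝ, X ≠ rowShrink μ M →
      (1 / (2 * μ)) * frobNorm (rowShrink μ M - M) ^ 2 + groupNorm (rowShrink μ M) <
        (1 / (2 * μ)) * frobNorm (X - M) ^ 2 + groupNorm X) ∧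
    groupNorm (rowShrink μ M) = ∑ i, max (rowNorm M i - μ) 0 := by
  constructor
  · intro X hX
    have hpos : 0 < ∑ i, ∑ j, (X i j - rowShrink μ M i j) ^ 2 := by
      have h0 : 0 ≤ ∑ i, ∑ j, (X i j - rowShrink μ M i j) ^ 2 :=
        Finset.sum_nonneg fun _ _ => Finset.sum_nonneg fun _ _ => sq_nonneg _
      refine lt_of_le_of_ne h0 fun h => hX ?_
      ext i j
      have h1 := (Finset.sum_eq_zero_iff_of_nonneg
        (fun i _ => Finset.sum_nonneg fun j _ => sq_nonneg (X i j - rowShrink μ M i j))).1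
        h.symm i (Finset.mem_univ i)
      have h2 := (Finset.sum_eq_zero_iff_of_nonneg
        (fun j _ => sq_nonneg (X i j - rowShrink μ M i j))).1 h1 j (Finset.mem_univ j)
      exact sub_eq_zero.1 (pow_eq_zero_iff two_ne_zero |>.1 h2)
    have hs := Finset.sum_le_sum fun i (_ : i ∈ Finset.univ) => row_ineq M X μ hμ i
    simp only [Finset.sum_add_distrib, ← Finset.mul_sum] at hs
    rw [frobNorm_sq', frobNorm_sq']
    simp only [Matrix.sub_apply, groupNorm]
    have key (A B : ℝ) : 1 / (2 * μ) * A + B = (A + 2 * μ * B) / (2 * μ) := by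
      field_simp
    rw [key, key]
    apply div_lt_div_of_pos_right _ (by positivity)
    linarith
  · unfold groupNorm
    refine Finset.sum_congr rfl fun i _ => ?_
    rw [rowNorm_shrink M μ hμ]
    rcases le_total (rowNorm M i) μ with h | h
    · rw [max_eq_right h, div_self hμ.ne', max_eq_right (by linarith)]; ring
    · have : rowNorm M i ≠ 0 := (hμ.trans_le h).ne'
      rw [max_eq_left h, max_eq_left (by linarith)]
      field_simp
end
end
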